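/- arXiv:0804.2833 — 2 statements merged into one kernel-verified Lean document; each statement's English description precedes it below -/
import Mathlib

section
/- Let n ≥ 3, 1 < p < n, 0 ≤ γ ≤ p, let Ω ⊆ ℝⁿ be a bounded connected open set such that ℝⁿ∖Ω is uniformly p-fat with constants c₀ and r₀, and fix x₀ ∈ Ω. Then there exists C > 0 such that the mixed Hardy inequality ∫_Ω |φ(x)|^p δ(x)^{−p+γ} |x − x₀|^{−γ} dx ≤ C ∫_Ω |∇φ(x)|^p dx holds for all φ ∈ C_c^∞(Ω). -/
open MeasureTheory Metric
open scoped NNReal ENNReal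

/-- The variational `p`-capacity of the condenser `(K, U)`: the infimum of `∫_U |∇φ|^p`
over Lipschitz functions `φ` with compact support contained in `U` with `φ ≥ 1` on `K`. -/
noncomputable def pCap (n : ℕ) (p : ℝ) (K U : Set (EuclideanSpace ℝ (Fin n))) : ℝ :=
  sInf { c : ℝ | ∃ φ : EuclideanSpace ℝ (Fin n) → ℝ, (∃ L : ℝ≥0, LipschitzWith L φ) ∧
    HasCompactSupport φ ∧ tsupport φ ⊆ U ∧ (∀ x ∈ K, 1 ≤ φ x) ∧
    c = ∫ x in U, ‖fderiv ℝ φ x‖ ^ p }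

/-- A closed set `E ⊆ ℝⁿ` is uniformly `p`-fat with constants `c₀, r₀ > 0` if
`cap_p(E ∩ B̄(x,r), B(x,2r)) ≥ c₀ · cap_p(B̄(x,r), B(x,2r))` for all `x ∈ ∂E`, `0 < r ≤ r₀`. -/
def UniformlyFat (n : ℕ) (p c₀ r₀ : ℝ) (E : Set (EuclideanSpace ℝ (Fin n))) : Prop :=
  ∀ x ∈ frontier E, ∀ r : ℝ, 0 < r → r ≤ r₀ →
    c₀ * pCap n p (closedBall x r) (ball x (2 * r)) ≤
      pCap n p (E ∩ closedBall x r) (ball x (2 * r))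

section Poincare

variable {E : Type*} [NormedAddCommGroup E] [NormedSpace ℝ E]

theorem LipschitzWith.enorm_sub_rpow_le_lintegral_fderiv {u : E → ℝ} {K : ℝ≥0}
    (hu : LipschitzWith K u) {p : ℝ} (hp : 1 ≤ p) (x v : E)
    (hd : ∀ᵐ t ∂(volume.restrict (Set.Ioc (0 : ℝ) 1)), DifferentiableAt ℝ u (x + t • v)) :
    ‖u (x + v) - u x‖ₑ ^ p ≤
      ‖v‖ₑ ^ p * ∫⁻ t in Set.Ioc (0 : ℝ) 1, ‖fderiv ℝ u (x + t • v)‖ₑ ^ p := by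
  have hp0 : 0 < p := by linarith
  set g : ℝ → ℝ := fun t => u (x + t • v) with hg
  have hline : LipschitzWith ‖v‖₊ (fun t : ℝ => x + t • v) := by
    refine LipschitzWith.of_dist_le_mul fun s t => ?_
    rw [dist_add_left, dist_eq_norm, ← sub_smul, norm_smul, mul_comm, Real.dist_eq, coe_nnnorm,
      Real.norm_eq_abs]
  have hgL : LipschitzWith (K * ‖v‖₊) g := hu.comp hline
  have hftc : ∫ t in (0 : ℝ)..1, deriv g t = u (x + v) - u x := by
    rw [(hgL.lipschitzOnWith
      (s := Set.uIcc 0 1)).absolutelyContinuousOnInterval.integral_deriv_eq_sub]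
    simp [hg]
  have hderiv : ∀ᵐ t ∂(volume.restrict (Set.Ioc (0 : ℝ) 1)),
      ‖deriv g t‖ₑ ≤ ‖v‖ₑ * ‖fderiv ℝ u (x + t • v)‖ₑ := by
    filter_upwards [hd] with t ht
    have h1 : HasDerivAt (fun t : ℝ => x + t • v) v t := by
      simpa using ((hasDerivAt_id t).smul_const v).const_add x
    have h2 : HasDerivAt g (fderiv ℝ u (x + t • v) v) t :=
      ht.hasFDerivAt.comp_hasDerivAt t h1
    rw [h2.deriv, mul_comm]
    exact (fderiv ℝ u (x + t • v)).le_opENorm v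
  have hprob : IsProbabilityMeasure (volume.restrict (Set.Ioc (0 : ℝ) 1)) := ⟨by simp⟩
  have hmeas : Measurable (deriv g) := measurable_deriv g
  have hjensen : (∫⁻ t in Set.Ioc (0 : ℝ) 1, ‖deriv g t‖ₑ) ^ p ≤
      ∫⁻ t in Set.Ioc (0 : ℝ) 1, ‖deriv g t‖ₑ ^ p := by
    have h := eLpNorm_le_eLpNorm_of_exponent_le (μ := volume.restrict (Set.Ioc (0 : ℝ) 1))
      (p := 1) (q := ENNReal.ofReal p) (f := deriv g) (by simpa using hp)
      hmeas.aestronglyMeasurable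
    rw [eLpNorm_one_eq_lintegral_enorm, eLpNorm_eq_lintegral_rpow_enorm_toReal
      (by simpa using hp0) (by simp), ENNReal.toReal_ofReal hp0.le] at h
    calc _ ≤ ((∫⁻ t in Set.Ioc (0 : ℝ) 1, ‖deriv g t‖ₑ ^ p) ^ (1 / p)) ^ p := by gcongr
      _ = _ := by rw [← ENNReal.rpow_mul, one_div_mul_cancel hp0.ne', ENNReal.rpow_one]
  calc ‖u (x + v) - u x‖ₑ ^ p ≤ (∫⁻ t in Set.Ioc (0 : ℝ) 1, ‖deriv g t‖ₑ) ^ p := by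
        gcongr
        rw [← hftc, intervalIntegral.integral_of_le zero_le_one]
        exact enorm_integral_le_lintegral_enorm _
    _ ≤ ∫⁻ t in Set.Ioc (0 : ℝ) 1, ‖deriv g t‖ₑ ^ p := hjensen
    _ ≤ ∫⁻ t in Set.Ioc (0 : ℝ) 1, ‖v‖ₑ ^ p * ‖fderiv ℝ u (x + t • v)‖ₑ ^ p := by
        refine lintegral_mono_ae ?_
        filter_upwards [hderiv] with t ht
        rw [← ENNReal.mul_rpow_of_nonneg _ _ hp0.le]
        gcongr
    _ = _ := lintegral_const_mul' _ _ (by simp [hp0.le])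

variable [FiniteDimensional ℝ E] [MeasurableSpace E] [BorelSpace E]
  (μ : Measure E) [μ.IsAddHaarMeasure]

theorem lintegral_comp_add_smul {f : E → ℝ≥0∞} (hf : Measurable f) (y : E) {t : ℝ} (ht : t ≠ 0) :
    ∫⁻ z, f (y + t • z) ∂μ =
      ENNReal.ofReal |(t ^ Module.finrank ℝ E)⁻¹| * ∫⁻ z, f z ∂μ := by
  have h1 : ∫⁻ z, f (y + t • z) ∂μ = ∫⁻ w, f (y + w) ∂(Measure.map (t • ·) μ) :=
    (lintegral_map (hf.comp (measurable_const_add y)) (measurable_const_smul t)).symm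
  rw [h1, Measure.map_addHaar_smul μ ht, lintegral_smul_measure, lintegral_add_left_eq_self]
  rfl

theorem LipschitzWith.lintegral_lintegral_enorm_sub_rpow_le {u : E → ℝ} {K : ℝ≥0}
    (hu : LipschitzWith K u) {p : ℝ} (hp : 1 ≤ p) {s : Set E} (hs : Convex ℝ s)
    (hsm : MeasurableSet s) {d : ℝ≥0∞} (hd : ∀ x ∈ s, ∀ z ∈ s, ‖z - x‖ₑ ≤ d) :
    ∫⁻ x in s, ∫⁻ z in s, ‖u z - u x‖ₑ ^ p ∂μ ∂μ ≤
      d ^ p * (2 ^ Module.finrank ℝ E * μ s * ∫⁻ z in s, ‖fderiv ℝ u z‖ₑ ^ p ∂μ) := by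
  have hp0 : 0 < p := by linarith
  have hfm : Measurable fun z => ‖fderiv ℝ u z‖ₑ ^ p := (measurable_fderiv ℝ u).enorm.pow_const p
  set G : E → ℝ≥0∞ := s.indicator fun z => ‖fderiv ℝ u z‖ₑ ^ p with hG
  have hGm : Measurable G := hfm.indicator hsm
  have hGi : ∫⁻ z, G z ∂μ = ∫⁻ z in s, ‖fderiv ℝ u z‖ₑ ^ p ∂μ := lintegral_indicator hsm _
  have hae : ∀ x : E, ∀ᵐ z ∂μ, ∀ᵐ t ∂(volume.restrict (Set.Ioc (0 : ℝ) 1)),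
      DifferentiableAt ℝ u (x + t • (z - x)) := by
    intro x
    have hm : MeasurableSet {q : E × ℝ | DifferentiableAt ℝ u (x + q.2 • (q.1 - x))} :=
      (measurableSet_of_differentiableAt ℝ u).preimage (by fun_prop)
    refine (Measure.ae_ae_comm (μ := volume.restrict (Set.Ioc (0 : ℝ) 1)) (ν := μ)
      (p := fun t z => DifferentiableAt ℝ u (x + t • (z - x))) (hm.preimage measurable_swap)).1 ?_
    filter_upwards [ae_restrict_mem measurableSet_Ioc] with t ht
    have hq : Measure.QuasiMeasurePreserving (fun z : E => (x - t • x) + t • z) μ μ :=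
      (measurePreserving_add_left μ _).quasiMeasurePreserving.comp
        (Measure.quasiMeasurePreserving_smul μ ht.1.ne')
    filter_upwards [hq.ae hu.ae_differentiableAt] with z hz
    rwa [show x + t • (z - x) = (x - t • x) + t • z by module]
  have hpt : ∀ x ∈ s, ∫⁻ z in s, ‖u z - u x‖ₑ ^ p ∂μ ≤
      d ^ p * ∫⁻ z in s, ∫⁻ t in Set.Ioc (0 : ℝ) 1, G (x + t • (z - x)) ∂volume ∂μ := by
    intro x hx
    rw [← lintegral_const_mul]
    swap
    · exact Measurable.lintegral_prod_right'
        (f := fun q : E × ℝ => G (x + q.2 • (q.1 - x))) (hGm.comp (by fun_prop))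
    refine lintegral_mono_ae ?_
    filter_upwards [ae_restrict_of_ae (hae x), ae_restrict_mem hsm] with z hz hzs
    have h := hu.enorm_sub_rpow_le_lintegral_fderiv hp x (z - x) hz
    rw [add_sub_cancel] at h
    refine h.trans ?_
    gcongr ?_ ^ p * ?_
    · exact hd x hx z hzs
    · refine setLIntegral_mono_ae' measurableSet_Ioc (ae_of_all _ fun t ht => ?_)
      have : x + t • (z - x) ∈ s := hs.add_smul_sub_mem hx hzs ⟨ht.1.le, ht.2⟩
      simp [hG, this]
  have hslice : ∀ t ∈ Set.Ioc (0 : ℝ) 1,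
      ∫⁻ x in s, ∫⁻ z in s, G (x + t • (z - x)) ∂μ ∂μ ≤
        2 ^ Module.finrank ℝ E * μ s * ∫⁻ z, G z ∂μ := by
    have key : ∀ a b : ℝ, 1 / 2 ≤ b → ∫⁻ x in s, ∫⁻ z in s, G (a • x + b • z) ∂μ ∂μ ≤
        2 ^ Module.finrank ℝ E * μ s * ∫⁻ z, G z ∂μ := by
      intro a b hb
      have hb0 : 0 < b := by linarith
      calc _ ≤ ∫⁻ x in s, 2 ^ Module.finrank ℝ E * ∫⁻ z, G z ∂μ ∂μ := by
            refine lintegral_mono fun x => (setLIntegral_le_lintegral _ _).trans ?_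
            rw [lintegral_comp_add_smul μ hGm _ hb0.ne']
            gcongr
            rw [abs_of_pos (by positivity), ← inv_pow, ENNReal.ofReal_pow (by positivity)]
            gcongr
            rw [← ENNReal.ofReal_ofNat]
            refine ENNReal.ofReal_le_ofReal ?_
            rw [inv_le_comm₀ hb0 (by norm_num)]; linarith
        _ = _ := by rw [lintegral_const, Measure.restrict_apply_univ]; ring
    intro t ht
    rcases le_total (1 / 2) t with h | h
    · refine le_trans (le_of_eq ?_) (key (1 - t) t h)
      congr! 5
      module
    · rw [lintegral_lintegral_swap]
      · refine le_trans (le_of_eq ?_) (key t (1 - t) (by linarith))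
        congr! 5
        module
      · exact (hGm.comp (by fun_prop)).aemeasurable
  have hm3 : Measurable fun q : (E × E) × ℝ => G (q.1.1 + q.2 • (q.1.2 - q.1.1)) :=
    hGm.comp (by fun_prop)
  calc _ ≤ ∫⁻ x in s, d ^ p *
        ∫⁻ z in s, ∫⁻ t in Set.Ioc (0 : ℝ) 1, G (x + t • (z - x)) ∂volume ∂μ ∂μ :=
        setLIntegral_mono_ae' hsm (ae_of_all _ hpt)
    _ = d ^ p * ∫⁻ x in s, ∫⁻ t in Set.Ioc (0 : ℝ) 1, ∫⁻ z in s, G (x + t • (z - x))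
          ∂μ ∂volume ∂μ := by
        rw [lintegral_const_mul]
        · congr 2
          funext x
          rw [lintegral_lintegral_swap]
          exact (hGm.comp (by fun_prop)).aemeasurable
        · exact Measurable.lintegral_prod_right'
            (f := fun q : E × E => ∫⁻ t in Set.Ioc (0 : ℝ) 1, G (q.1 + t • (q.2 - q.1)))
            (Measurable.lintegral_prod_right' hm3)
    _ = d ^ p * ∫⁻ t in Set.Ioc (0 : ℝ) 1, ∫⁻ x in s, ∫⁻ z in s, G (x + t • (z - x)) ∂μ ∂μ := by
        rw [lintegral_lintegral_swap]
        refine (Measurable.lintegral_prod_right'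
          (f := fun q : (E × ℝ) × E => G (q.1.1 + q.1.2 • (q.2 - q.1.1))) ?_).aemeasurable
        exact hGm.comp (by fun_prop)
    _ ≤ d ^ p * ∫⁻ t in Set.Ioc (0 : ℝ) 1, 2 ^ Module.finrank ℝ E * μ s * ∫⁻ z, G z ∂μ := by
        gcongr d ^ p * ?_
        exact setLIntegral_mono_ae' measurableSet_Ioc (ae_of_all _ hslice)
    _ = _ := by simp [hGi]

theorem LipschitzWith.exists_lintegral_ball_enorm_sub_rpow_le {u : E → ℝ} {K : ℝ≥0}
    (hu : LipschitzWith K u) {p : ℝ} (hp : 1 ≤ p) (y : E) {R : ℝ} (hR : 0 < R) :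
    ∃ m : ℝ, ∫⁻ z in ball y R, ‖u z - m‖ₑ ^ p ∂μ ≤
      ENNReal.ofReal (2 * R) ^ p *
        (2 ^ Module.finrank ℝ E * ∫⁻ z in ball y R, ‖fderiv ℝ u z‖ₑ ^ p ∂μ) := by
  have hB0 : μ (ball y R) ≠ 0 := (measure_ball_pos μ y hR).ne'
  have hB1 : μ (ball y R) ≠ ∞ := measure_ball_lt_top.ne
  have hcont := hu.continuous
  have hd : ∀ x ∈ ball y R, ∀ z ∈ ball y R, ‖z - x‖ₑ ≤ ENNReal.ofReal (2 * R) := by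
    intro x hx z hz
    rw [← ofReal_norm, ← dist_eq_norm]
    refine ENNReal.ofReal_le_ofReal ?_
    linarith [dist_triangle_right z x y, mem_ball.1 hx, mem_ball.1 hz]
  have hP := hu.lintegral_lintegral_enorm_sub_rpow_le μ hp (convex_ball y R) measurableSet_ball hd
  have hm : Measurable fun x => ∫⁻ z in ball y R, ‖u z - u x‖ₑ ^ p ∂μ :=
    Measurable.lintegral_prod_right' (f := fun q : E × E => ‖u q.2 - u q.1‖ₑ ^ p)
      (Continuous.measurable (by fun_prop) |>.enorm.pow_const p)
  have : IsFiniteMeasure (μ.restrict (ball y R)) := isFiniteMeasure_restrict.2 hB1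
  obtain ⟨x, hx⟩ := exists_le_laverage (μ := μ.restrict (ball y R))
    (by rwa [Ne, Measure.restrict_eq_zero]) hm.aemeasurable
  refine ⟨u x, hx.trans ?_⟩
  rw [setLAverage_eq]
  refine ENNReal.div_le_of_le_mul (hP.trans (le_of_eq (by ring)))

/-- The Friedrichs inequality for Lipschitz functions supported in a ball. -/
theorem LipschitzWith.lintegral_enorm_rpow_le_of_support_subset_ball [Nontrivial E] {u : E → ℝ}
    {K : ℝ≥0} (hu : LipschitzWith K u) {p : ℝ} (hp : 1 ≤ p) (y : E) {R : ℝ} (hR : 0 < R)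
    (hsupp : ∀ x ∉ ball y R, u x = 0) :
    ∫⁻ z, ‖u z‖ₑ ^ p ∂μ ≤ ENNReal.ofReal (4 * R) ^ p *
      (4 ^ Module.finrank ℝ E * ∫⁻ z, ‖fderiv ℝ u z‖ₑ ^ p ∂μ) := by
  have hp0 : 0 < p := by linarith
  have hB0 : μ (ball y R) ≠ 0 := (measure_ball_pos μ y hR).ne'
  have hB1 : μ (ball y R) ≠ ∞ := measure_ball_lt_top.ne
  have hcont := hu.continuous
  have hsub : ball y R ⊆ ball y (2 * R) := ball_subset_ball (by linarith)
  have hvol : μ (ball y (2 * R)) = 2 ^ Module.finrank ℝ E * μ (ball y R) := by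
    rw [Measure.addHaar_ball_mul μ y zero_le_two, Measure.addHaar_ball_center μ y R,
      ENNReal.ofReal_pow zero_le_two, ENNReal.ofReal_ofNat]
  have hd : ∀ x ∈ ball y (2 * R), ∀ z ∈ ball y (2 * R), ‖z - x‖ₑ ≤ ENNReal.ofReal (4 * R) := by
    intro x hx z hz
    rw [← ofReal_norm, ← dist_eq_norm]
    refine ENNReal.ofReal_le_ofReal ?_
    linarith [dist_triangle_right z x y, mem_ball.1 hx, mem_ball.1 hz]
  have hP := hu.lintegral_lintegral_enorm_sub_rpow_le μ hp (convex_ball y (2 * R))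
    measurableSet_ball hd
  have hann : μ (ball y R) ≤ μ (ball y (2 * R) \ ball y R) := by
    rw [measure_sdiff hsub measurableSet_ball.nullMeasurableSet hB1, hvol]
    refine ENNReal.le_sub_of_add_le_left hB1 ?_
    rw [← two_mul]
    gcongr
    exact le_self_pow₀ one_le_two Module.finrank_pos.ne'
  have hint : ∫⁻ z in ball y (2 * R), ‖u z‖ₑ ^ p ∂μ = ∫⁻ z, ‖u z‖ₑ ^ p ∂μ := by
    refine setLIntegral_eq_of_support_subset ?_
    intro z hz
    by_contra h
    exact hz (by simp [hsupp z fun h' => h (hsub h'), hp0])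
  have hlow : μ (ball y R) * ∫⁻ z, ‖u z‖ₑ ^ p ∂μ ≤
      ∫⁻ x in ball y (2 * R), ∫⁻ z in ball y (2 * R), ‖u z - u x‖ₑ ^ p ∂μ ∂μ := by
    calc _ ≤ μ (ball y (2 * R) \ ball y R) * ∫⁻ z, ‖u z‖ₑ ^ p ∂μ := by gcongr
      _ = ∫⁻ x in ball y (2 * R) \ ball y R, ∫⁻ z in ball y (2 * R), ‖u z‖ₑ ^ p ∂μ ∂μ := by
          rw [lintegral_const, Measure.restrict_apply_univ, hint, mul_comm]
      _ = ∫⁻ x in ball y (2 * R) \ ball y R,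
            ∫⁻ z in ball y (2 * R), ‖u z - u x‖ₑ ^ p ∂μ ∂μ := by
          refine setLIntegral_congr_fun (measurableSet_ball.diff measurableSet_ball) ?_
          intro x hx
          simp only [hsupp x hx.2, sub_zero]
      _ ≤ _ := lintegral_mono_set Set.sdiff_subset
  refine (ENNReal.mul_le_mul_iff_right hB0 hB1).1 ?_
  refine hlow.trans (hP.trans ?_)
  rw [hvol, show (4 : ℝ≥0∞) ^ Module.finrank ℝ E =
    2 ^ Module.finrank ℝ E * 2 ^ Module.finrank ℝ E by rw [← mul_pow]; norm_num]
  calc _ ≤ ENNReal.ofReal (4 * R) ^ p * (2 ^ Module.finrank ℝ E *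
        (2 ^ Module.finrank ℝ E * μ (ball y R)) * ∫⁻ z, ‖fderiv ℝ u z‖ₑ ^ p ∂μ) := by
        gcongr; exact Measure.restrict_le_self
    _ = _ := by ring

/-- The classical Hardy inequality with a singularity at the origin, for `1 ≤ p < dim E`. -/
theorem LipschitzWith.lintegral_hardy_origin {u : E → ℝ} {K : ℝ≥0} (hu : LipschitzWith K u)
    (hdiff : Differentiable ℝ u) (hc : HasCompactSupport u) {p : ℝ} (hp : 1 ≤ p)
    (hpn : p < Module.finrank ℝ E) :
    ∫⁻ x, ‖u x‖ₑ ^ p * ‖x‖ₑ ^ (-p) ∂μ ≤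
      ENNReal.ofReal ((1 - 2 ^ (1 - Module.finrank ℝ E / p))⁻¹) ^ p *
        ∫⁻ x, ‖fderiv ℝ u x‖ₑ ^ p ∂μ := by
  have hp0 : 0 < p := by linarith
  have hE : Nontrivial E := by
    refine Module.nontrivial_of_finrank_pos (R := ℝ) ?_
    have : (0 : ℝ) < Module.finrank ℝ E := by linarith
    exact_mod_cast this
  have hcont := hu.continuous
  have hfm : Measurable fun z => ‖fderiv ℝ u z‖ₑ ^ p := (measurable_fderiv ℝ u).enorm.pow_const p
  set n := Module.finrank ℝ E with hn
  set I : ℝ≥0∞ := ∫⁻ x, ‖fderiv ℝ u x‖ₑ ^ p ∂μ with hI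
  set H : E → ℝ≥0∞ := fun x => ‖u x‖ₑ ^ p * ‖x‖ₑ ^ (-p) with hH
  have hHm : Measurable H := (hcont.measurable.enorm.pow_const p).mul
    (measurable_id.enorm.pow_const (-p))
  have hinc : ∫⁻ x, ‖u (x + x) - u x‖ₑ ^ p * ‖x‖ₑ ^ (-p) ∂μ ≤ I := by
    calc _ ≤ ∫⁻ x, ∫⁻ t in Set.Ioc (0 : ℝ) 1, ‖fderiv ℝ u (x + t • x)‖ₑ ^ p ∂volume ∂μ := by
          refine lintegral_mono_ae ?_
          filter_upwards [compl_mem_ae_iff.2 (measure_singleton (μ := μ) (0 : E))] with x hx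
          have hx0 : ‖x‖ₑ ≠ 0 := by simpa using hx
          calc _ ≤ ‖x‖ₑ ^ p * (∫⁻ t in Set.Ioc (0 : ℝ) 1, ‖fderiv ℝ u (x + t • x)‖ₑ ^ p)
                  * ‖x‖ₑ ^ (-p) := by
                gcongr
                exact hu.enorm_sub_rpow_le_lintegral_fderiv hp x x (ae_of_all _ fun t => hdiff _)
            _ = ‖x‖ₑ ^ p * ‖x‖ₑ ^ (-p) *
                  (∫⁻ t in Set.Ioc (0 : ℝ) 1, ‖fderiv ℝ u (x + t • x)‖ₑ ^ p) := by ring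
            _ = _ := by
                rw [← ENNReal.rpow_add _ _ hx0 (by simp), add_neg_cancel, ENNReal.rpow_zero,
                  one_mul]
      _ = ∫⁻ t in Set.Ioc (0 : ℝ) 1, ∫⁻ x, ‖fderiv ℝ u (x + t • x)‖ₑ ^ p ∂μ := by
          rw [lintegral_lintegral_swap]
          have hline : Measurable fun z : E × ℝ => z.1 + z.2 • z.1 := by fun_prop
          exact (hfm.comp hline).aemeasurable
      _ ≤ ∫⁻ t in Set.Ioc (0 : ℝ) 1, I := by
          refine setLIntegral_mono_ae' measurableSet_Ioc (ae_of_all _ fun t ht => ?_)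
          have h1 : 0 < 1 + t := by linarith [ht.1]
          have h2 : ∀ x : E, x + t • x = 0 + (1 + t) • x := fun x => by module
          simp_rw [h2]
          rw [lintegral_comp_add_smul μ hfm 0 h1.ne']
          refine mul_le_of_le_one_left' ?_
          rw [ENNReal.ofReal_le_one, abs_of_pos (by positivity)]
          exact inv_le_one_of_one_le₀ (one_le_pow₀ (by linarith [ht.1]))
      _ = I := by simp
  set θ : ℝ := 2 ^ (1 - n / p) with hθ
  have hθ0 : 0 < θ := by positivity
  have hθ1 : θ < 1 := by
    refine Real.rpow_lt_one_of_one_lt_of_neg one_lt_two ?_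
    rw [sub_neg, one_lt_div hp0]
    exact hpn
  have htrunc : ∀ ε : ℝ, 0 < ε → ∫⁻ x in {x | ε ≤ ‖x‖}, H x ∂μ ≤
      ENNReal.ofReal ((1 - θ)⁻¹) ^ p * I := by
    intro ε hε
    set A : Set E := {x | ε ≤ ‖x‖} with hA
    have hAm : MeasurableSet A := measurableSet_le measurable_const measurable_norm
    set N : ℝ≥0∞ := ∫⁻ x in A, H x ∂μ with hN
    have hNfin : N ≠ ∞ := by
      obtain ⟨M, hM⟩ := hc.exists_bound_of_continuous hcont
      have hb : ∀ x ∈ A, H x ≤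
          (tsupport u).indicator (fun _ => ENNReal.ofReal M ^ p * ENNReal.ofReal ε ^ (-p)) x := by
        intro x hx
        by_cases hxs : x ∈ tsupport u
        · rw [Set.indicator_of_mem hxs]
          simp only [hH]
          gcongr ?_ ^ p * ?_
          · rw [← ofReal_norm]; exact ENNReal.ofReal_le_ofReal (hM x)
          · rw [ENNReal.rpow_neg, ENNReal.rpow_neg]
            gcongr
            rw [← ofReal_norm]; exact ENNReal.ofReal_le_ofReal hx
        · simp [hH, image_eq_zero_of_notMem_tsupport hxs, hp0]
      refine ((setLIntegral_mono_ae' hAm (ae_of_all _ hb)).trans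
        (setLIntegral_le_lintegral _ _)).trans_lt ?_ |>.ne
      rw [lintegral_indicator (isClosed_tsupport u).measurableSet, lintegral_const,
        Measure.restrict_apply_univ]
      refine ENNReal.mul_lt_top (ENNReal.mul_lt_top ?_ ?_) hc.isCompact.measure_lt_top
      · exact ENNReal.rpow_lt_top_of_nonneg hp0.le ENNReal.ofReal_ne_top
      · rw [ENNReal.rpow_neg]
        refine ENNReal.inv_lt_top.2 (ENNReal.rpow_pos ?_ ENNReal.ofReal_ne_top)
        exact ENNReal.ofReal_pos.2 hε
    have hscale : ∫⁻ x in A, ‖u (x + x)‖ₑ ^ p * ‖x‖ₑ ^ (-p) ∂μ ≤ ENNReal.ofReal θ ^ p * N := by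
      have hAH : Measurable (A.indicator H) := hHm.indicator hAm
      calc _ = ∫⁻ x in A, 2 ^ p * H (0 + (2 : ℝ) • x) ∂μ := by
            congr 1
            funext x
            have h2 : ‖(2 : ℝ)‖ₑ = 2 := by rw [← ofReal_norm]; simp
            simp only [hH, zero_add, enorm_smul, h2]
            rw [ENNReal.mul_rpow_of_ne_top (by simp) (by simp), two_smul ℝ x]
            calc _ = 2 ^ p * 2 ^ (-p) * (‖u (x + x)‖ₑ ^ p * ‖x‖ₑ ^ (-p)) := by
                  rw [← ENNReal.rpow_add _ _ (by simp) (by simp), add_neg_cancel,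
                    ENNReal.rpow_zero, one_mul]
              _ = _ := by ring
        _ ≤ ∫⁻ x, 2 ^ p * A.indicator H (0 + (2 : ℝ) • x) ∂μ := by
            rw [← lintegral_indicator hAm]
            refine lintegral_mono fun x => ?_
            by_cases hx : x ∈ A
            · rw [Set.indicator_of_mem hx]
              have h2 : 0 + (2 : ℝ) • x ∈ A := by
                simp only [hA, Set.mem_ofPred_eq, zero_add, norm_smul] at hx ⊢
                norm_num
                linarith
              rw [Set.indicator_of_mem h2]
            · rw [Set.indicator_of_notMem hx]
              exact zero_le
        _ = 2 ^ p * (ENNReal.ofReal |(2 ^ n)⁻¹| * N) := by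
            rw [lintegral_const_mul' _ _ (by simp),
              lintegral_comp_add_smul μ hAH 0 two_ne_zero, lintegral_indicator hAm]
        _ = ENNReal.ofReal θ ^ p * N := by
            rw [← mul_assoc]
            congr 1
            rw [← ENNReal.ofReal_ofNat, ENNReal.ofReal_rpow_of_pos two_pos,
              ENNReal.ofReal_rpow_of_pos hθ0, ← ENNReal.ofReal_mul (by positivity), hθ,
              abs_of_pos (by positivity), ← Real.rpow_natCast, ← Real.rpow_neg two_pos.le,
              ← Real.rpow_add two_pos, ← Real.rpow_mul two_pos.le]
            congr 2
            field_simp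
            ring
    have hmink : N ^ (1 / p) ≤ I ^ (1 / p) + ENNReal.ofReal θ * N ^ (1 / p) := by
      set f : E → ℝ≥0∞ := fun x => ‖u (x + x) - u x‖ₑ * ‖x‖ₑ ^ (-1 : ℝ) with hf
      set g : E → ℝ≥0∞ := fun x => ‖u (x + x)‖ₑ * ‖x‖ₑ ^ (-1 : ℝ) with hg
      have hpow : ∀ x : E, (‖x‖ₑ ^ (-1 : ℝ)) ^ p = ‖x‖ₑ ^ (-p) := fun x => by
        rw [← ENNReal.rpow_mul, neg_one_mul]
      have hfm : AEMeasurable f (μ.restrict A) :=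
        ((Continuous.measurable (by fun_prop)).enorm.mul
          (measurable_id.enorm.pow_const _)).aemeasurable
      have hgm : AEMeasurable g (μ.restrict A) :=
        ((Continuous.measurable (by fun_prop)).enorm.mul
          (measurable_id.enorm.pow_const _)).aemeasurable
      calc N ^ (1 / p) ≤ (∫⁻ x in A, (f + g) x ^ p ∂μ) ^ (1 / p) := by
            gcongr
            refine lintegral_mono fun x => ?_
            simp only [hH, Pi.add_apply, hf, hg]
            rw [← hpow, ← add_mul, ENNReal.mul_rpow_of_nonneg _ _ hp0.le]
            gcongr
            rw [add_comm]
            simpa using enorm_sub_le (a := u (x + x)) (b := u (x + x) - u x)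
        _ ≤ (∫⁻ x in A, f x ^ p ∂μ) ^ (1 / p) + (∫⁻ x in A, g x ^ p ∂μ) ^ (1 / p) :=
            ENNReal.lintegral_Lp_add_le hfm hgm hp
        _ ≤ I ^ (1 / p) + (ENNReal.ofReal θ ^ p * N) ^ (1 / p) := by
            simp only [hf, hg, ENNReal.mul_rpow_of_nonneg _ _ hp0.le, hpow]
            gcongr
            exact (setLIntegral_le_lintegral _ _).trans hinc
        _ = _ := by
            rw [ENNReal.mul_rpow_of_nonneg _ _ (by positivity), ← ENNReal.rpow_mul,
              mul_one_div_cancel hp0.ne', ENNReal.rpow_one]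
    have hNp : N ^ (1 / p) ≠ ∞ := ENNReal.rpow_ne_top_of_nonneg (by positivity) hNfin
    have hroot : N ^ (1 / p) ≤ ENNReal.ofReal ((1 - θ)⁻¹) * I ^ (1 / p) := by
      have h1 : ENNReal.ofReal (1 - θ) * N ^ (1 / p) ≤ I ^ (1 / p) := by
        rw [ENNReal.ofReal_sub _ hθ0.le, ENNReal.ofReal_one, ENNReal.sub_mul (fun _ _ => hNp),
          one_mul]
        exact tsub_le_iff_right.2 hmink
      rw [ENNReal.ofReal_inv_of_pos (by linarith), mul_comm, ← div_eq_mul_inv,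
        ENNReal.le_div_iff_mul_le (by simp [hθ1]) (by simp), mul_comm]
      exact h1
    calc N = (N ^ (1 / p)) ^ p := by
          rw [← ENNReal.rpow_mul, one_div_mul_cancel hp0.ne', ENNReal.rpow_one]
      _ ≤ (ENNReal.ofReal ((1 - θ)⁻¹) * I ^ (1 / p)) ^ p := by gcongr
      _ = _ := by
          rw [ENNReal.mul_rpow_of_nonneg _ _ hp0.le, ← ENNReal.rpow_mul,
            one_div_mul_cancel hp0.ne', ENNReal.rpow_one]
  have hunion : (⋃ k : ℕ, {x : E | 1 / ((k : ℝ) + 1) ≤ ‖x‖}) = {0}ᶜ := by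
    ext x
    simp only [Set.mem_iUnion, Set.mem_ofPred_eq, Set.mem_compl_iff, Set.mem_singleton_iff]
    constructor
    · rintro ⟨k, hk⟩ rfl
      rw [norm_zero] at hk
      have : 0 < 1 / ((k : ℝ) + 1) := by positivity
      linarith
    · intro hx
      obtain ⟨k, hk⟩ := exists_nat_one_div_lt (norm_pos_iff.2 hx)
      exact ⟨k, hk.le⟩
  have hdir : Directed (· ⊆ ·) fun k : ℕ => {x : E | 1 / ((k : ℝ) + 1) ≤ ‖x‖} := by
    refine Monotone.directed_le (f := fun k : ℕ => {x : E | 1 / ((k : ℝ) + 1) ≤ ‖x‖}) ?_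
    intro i j hij x hx
    exact le_trans (Nat.one_div_le_one_div hij) (show 1 / ((i : ℝ) + 1) ≤ ‖x‖ from hx)
  have hcompl : ∫⁻ x, H x ∂μ = ∫⁻ x in {0}ᶜ, H x ∂μ := by
    rw [Measure.restrict_eq_self_of_ae_mem]
    exact compl_mem_ae_iff.2 (measure_singleton (μ := μ) (0 : E))
  rw [hcompl, ← hunion, setLIntegral_iUnion_of_directed _ hdir]
  exact iSup_le fun k => htrunc _ (by positivity)

end Poincare

section Capacity

theorem LipschitzWith.mul_of_bounded {X : Type*} [PseudoMetricSpace X] {f g : X → ℝ}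
    {Kf Kg A B : ℝ≥0} (hf : LipschitzWith Kf f) (hg : LipschitzWith Kg g)
    (hA : ∀ x, |f x| ≤ A) (hB : ∀ x, |g x| ≤ B) :
    LipschitzWith (A * Kg + B * Kf) fun x => f x * g x := by
  refine LipschitzWith.of_dist_le_mul fun x y => ?_
  have hf' := hf.dist_le_mul x y
  have hg' := hg.dist_le_mul x y
  rw [Real.dist_eq] at hf' hg' ⊢
  have : f x * g x - f y * g y = f x * (g x - g y) + g y * (f x - f y) := by ring
  rw [this]
  calc _ ≤ |f x * (g x - g y)| + |g y * (f x - f y)| := abs_add_le _ _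
    _ = |f x| * |g x - g y| + |g y| * |f x - f y| := by rw [abs_mul, abs_mul]
    _ ≤ A * (Kg * dist x y) + B * (Kf * dist x y) := by
        gcongr
        · exact hA x
        · exact hB y
    _ = _ := by push_cast; ring

theorem exists_lipschitz_cutoff {X : Type*} [PseudoMetricSpace X] [ProperSpace X] (y : X) {r : ℝ}
    (hr : 0 < r) :
    ∃ η : X → ℝ, LipschitzWith (2 / r).toNNReal η ∧ HasCompactSupport η ∧
      tsupport η ⊆ ball y (2 * r) ∧ (∀ x, |η x| ≤ 1) ∧ ∀ x ∈ closedBall y r, η x = 1 := by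
  have hsub : tsupport (fun x => max 0 (min 1 (3 - 2 / r * dist x y))) ⊆
      closedBall y (3 / 2 * r) := by
    refine closure_minimal (fun x hx => ?_) isClosed_closedBall
    by_contra h
    rw [mem_closedBall, not_le] at h
    refine hx (max_eq_left ((min_le_right _ _).trans ?_))
    have : 3 / 2 * r * (2 / r) = 3 := by field_simp
    nlinarith [mul_lt_mul_of_pos_right h (show 0 < 2 / r by positivity)]
  refine ⟨fun x => max 0 (min 1 (3 - 2 / r * dist x y)), ?_, ?_, ?_, ?_, ?_⟩
  · refine LipschitzWith.const_max (LipschitzWith.const_min ?_ 1) 0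
    refine LipschitzWith.of_dist_le_mul fun x z => ?_
    rw [Real.dist_eq, Real.coe_toNNReal _ (by positivity),
      show 3 - 2 / r * dist x y - (3 - 2 / r * dist z y) = 2 / r * (dist z y - dist x y) by ring,
      abs_mul, abs_of_pos (show 0 < 2 / r by positivity), dist_comm x z]
    gcongr
    exact abs_dist_sub_le _ _ _
  · exact HasCompactSupport.of_support_subset_isCompact (isCompact_closedBall y (3 / 2 * r))
      ((subset_tsupport _).trans hsub)
  · exact hsub.trans (closedBall_subset_ball (by linarith))
  · intro x
    rw [abs_of_nonneg (le_max_left _ _)]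
    exact max_le zero_le_one (min_le_left _ _)
  · intro x hx
    have h1 : 2 / r * dist x y ≤ 2 := by
      rw [div_mul_eq_mul_div, div_le_iff₀ hr]
      have := mem_closedBall.1 hx
      linarith
    change max 0 (min 1 (3 - 2 / r * dist x y)) = 1
    rw [min_eq_left (by linarith), max_eq_right zero_le_one]

variable {E : Type*} [NormedAddCommGroup E] [NormedSpace ℝ E]
  [MeasurableSpace E]

theorem setLIntegral_enorm_fderiv_rpow_eq (μ : Measure E) {φ : E → ℝ} {p : ℝ} (hp : 0 < p)
    {s : Set E} (hs : tsupport φ ⊆ s) :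
    ∫⁻ x in s, ‖fderiv ℝ φ x‖ₑ ^ p ∂μ = ∫⁻ x, ‖fderiv ℝ φ x‖ₑ ^ p ∂μ := by
  refine setLIntegral_eq_of_support_subset fun x hx => hs ?_
  by_contra h
  refine hx ?_
  have := image_eq_zero_of_notMem_tsupport (fun h' => h (tsupport_fderiv_subset ℝ h'))
  simp [← ofReal_norm, this, hp]

variable [BorelSpace E]

theorem LipschitzWith.ofReal_integral_norm_fderiv_rpow (μ : Measure E) [IsFiniteMeasureOnCompacts μ]
    {φ : E → ℝ} {K : ℝ≥0} (hφ : LipschitzWith K φ) (hc : HasCompactSupport φ) {p : ℝ} (hp : 0 < p)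
    (s : Set E) :
    ENNReal.ofReal (∫ x in s, ‖fderiv ℝ φ x‖ ^ p ∂μ) = ∫⁻ x in s, ‖fderiv ℝ φ x‖ₑ ^ p ∂μ := by
  have hm : Measurable fun x => ‖fderiv ℝ φ x‖ ^ p := (measurable_fderiv ℝ φ).norm.pow_const p
  have hint : Integrable (fun x => ‖fderiv ℝ φ x‖ ^ p) μ := by
    have hsub : (Function.support fun x => ‖fderiv ℝ φ x‖ ^ p) ⊆ tsupport φ := by
      intro x hx
      by_contra h
      refine hx ?_
      have := image_eq_zero_of_notMem_tsupport (fun h' => h (tsupport_fderiv_subset ℝ h'))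
      simp [this, hp.ne']
    rw [← integrableOn_iff_integrable_of_support_subset hsub]
    refine Measure.integrableOn_of_bounded (M := (K : ℝ) ^ p) hc.isCompact.measure_lt_top.ne
      hm.aestronglyMeasurable (ae_of_all _ fun x => ?_)
    rw [Real.norm_of_nonneg (by positivity)]
    gcongr
    exact norm_fderiv_le_of_lipschitz ℝ hφ
  rw [ofReal_integral_eq_lintegral_ofReal hint.integrableOn (ae_of_all _ fun x => by positivity)]
  congr 1
  funext x
  rw [← ofReal_norm, ENNReal.ofReal_rpow_of_nonneg (norm_nonneg _) hp.le]

theorem bddBelow_pCap_set (n : ℕ) (p : ℝ) (K U : Set (EuclideanSpace ℝ (Fin n))) :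
    BddBelow { c : ℝ | ∃ φ : EuclideanSpace ℝ (Fin n) → ℝ, (∃ L : ℝ≥0, LipschitzWith L φ) ∧
      HasCompactSupport φ ∧ tsupport φ ⊆ U ∧ (∀ x ∈ K, 1 ≤ φ x) ∧
      c = ∫ x in U, ‖fderiv ℝ φ x‖ ^ p } := by
  refine ⟨0, ?_⟩
  rintro c ⟨φ, -, -, -, -, rfl⟩
  exact integral_nonneg fun x => by positivity

theorem exists_mul_rpow_le_pCap_closedBall (n : ℕ) (hn : 0 < n) {p : ℝ} (hp : 1 ≤ p) :
    ∃ c : ℝ, 0 < c ∧ ∀ (y : EuclideanSpace ℝ (Fin n)) (r : ℝ), 0 < r →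
      c * r ^ (n - p) ≤ pCap n p (closedBall y r) (ball y (2 * r)) := by
  have hp0 : 0 < p := by linarith
  have : Nontrivial (EuclideanSpace ℝ (Fin n)) :=
    Module.nontrivial_of_finrank_pos (R := ℝ) (by simpa using hn)
  set ω : ℝ := volume.real (ball (0 : EuclideanSpace ℝ (Fin n)) 1) with hω
  have hωfin : volume (ball (0 : EuclideanSpace ℝ (Fin n)) 1) ≠ ∞ := measure_ball_lt_top.ne
  have hωpos : 0 < ω := ENNReal.toReal_pos (measure_ball_pos _ _ one_pos).ne' hωfin
  refine ⟨ω / (8 ^ p * 4 ^ n), by positivity, fun y r hr => ?_⟩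
  obtain ⟨η, hηL, hηc, hηs, -, hη1⟩ := exists_lipschitz_cutoff y hr
  refine le_csInf ⟨_, η, ⟨_, hηL⟩, hηc, hηs, fun x hx => (hη1 x hx).ge, rfl⟩ ?_
  rintro c ⟨φ, ⟨L, hL⟩, hφc, hφs, hφ1, rfl⟩
  rw [← ENNReal.ofReal_le_ofReal_iff (integral_nonneg fun x => by positivity),
    hL.ofReal_integral_norm_fderiv_rpow volume hφc hp0, setLIntegral_enorm_fderiv_rpow_eq _ hp0 hφs]
  have hF := hL.lintegral_enorm_rpow_le_of_support_subset_ball volume hp y (R := 2 * r)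
    (by positivity) fun x hx => image_eq_zero_of_notMem_tsupport fun h => hx (hφs h)
  have hlow : volume (ball y r) ≤ ∫⁻ z, ‖φ z‖ₑ ^ p := by
    calc volume (ball y r) = ∫⁻ z in ball y r, 1 := by simp
      _ ≤ ∫⁻ z in ball y r, ‖φ z‖ₑ ^ p := by
          refine setLIntegral_mono_ae' measurableSet_ball (ae_of_all _ fun z hz => ?_)
          refine ENNReal.one_le_rpow ?_ hp0
          rw [← ofReal_norm, ENNReal.one_le_ofReal]
          exact (hφ1 z (ball_subset_closedBall hz)).trans (le_abs_self _)
      _ ≤ _ := setLIntegral_le_lintegral _ _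
  have hvol : volume (ball y r) = ENNReal.ofReal (r ^ n * ω) := by
    rw [Measure.addHaar_ball volume y hr.le, finrank_euclideanSpace_fin,
      ENNReal.ofReal_mul (by positivity), hω, ofReal_measureReal hωfin]
  have h := hlow.trans hF
  rw [hvol, finrank_euclideanSpace_fin, ← mul_assoc,
    show ENNReal.ofReal (4 * (2 * r)) ^ p * 4 ^ n = ENNReal.ofReal ((8 * r) ^ p * 4 ^ n) by
      rw [← mul_assoc, ENNReal.ofReal_rpow_of_pos (by positivity),
        ENNReal.ofReal_mul (by positivity), ENNReal.ofReal_pow (by norm_num), ENNReal.ofReal_ofNat]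
      norm_num] at h
  have hpos : 0 < (8 * r) ^ p * 4 ^ n := by positivity
  have h := (ENNReal.div_le_iff (by simpa using hpos) (by simp)).2 (h.trans_eq (mul_comm _ _))
  rw [← ENNReal.ofReal_div_of_pos hpos] at h
  convert h using 2
  rw [Real.rpow_sub hr, Real.rpow_natCast, Real.mul_rpow (by norm_num) hr.le]
  field_simp

theorem pCap_le_of_eq_zero_on {n : ℕ} {p : ℝ} (hp : 1 ≤ p)
    {u : EuclideanSpace ℝ (Fin n) → ℝ} {L : ℝ≥0} (hu : LipschitzWith L u)
    (huc : HasCompactSupport u) {F : Set (EuclideanSpace ℝ (Fin n))} (hF : ∀ x ∈ F, u x = 0)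
    (y : EuclideanSpace ℝ (Fin n)) {r : ℝ} (hr : 0 < r) (m : ℝ) :
    ‖m‖ₑ ^ p * ENNReal.ofReal (pCap n p (F ∩ closedBall y r) (ball y (2 * r))) ≤
      2 ^ p * ((∫⁻ x in ball y (2 * r), ‖fderiv ℝ u x‖ₑ ^ p) +
        ENNReal.ofReal (2 / r) ^ p * ∫⁻ x in ball y (2 * r), ‖u x - m‖ₑ ^ p) := by
  have hp0 : 0 < p := by linarith
  rcases eq_or_ne m 0 with rfl | hm
  · simp [hp0]
  obtain ⟨η, hηL, hηc, hηs, hηb, hη1⟩ := exists_lipschitz_cutoff y hr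
  set w : EuclideanSpace ℝ (Fin n) → ℝ := fun x => m⁻¹ * (m - u x) with hw
  have hwL : LipschitzWith (‖m⁻¹‖₊ * L) w := by
    refine LipschitzWith.of_dist_le_mul fun x z => ?_
    have := hu.dist_le_mul x z
    rw [Real.dist_eq] at this ⊢
    rw [hw, ← mul_sub, abs_mul, sub_sub_sub_cancel_left, abs_sub_comm, NNReal.coe_mul, coe_nnnorm,
      Real.norm_eq_abs, mul_assoc]
    gcongr
  obtain ⟨M, hM⟩ := huc.exists_bound_of_continuous hu.continuous
  have hwb : ∀ x, |w x| ≤ (‖m⁻¹‖₊ * (‖m‖₊ + M.toNNReal) : ℝ≥0) := by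
    intro x
    rw [hw, abs_mul, NNReal.coe_mul, coe_nnnorm, Real.norm_eq_abs]
    gcongr
    refine (abs_sub _ _).trans ?_
    push_cast
    gcongr
    · exact le_rfl
    · exact (hM x).trans (Real.le_coe_toNNReal M)
  have hφL := hηL.mul_of_bounded hwL (A := 1) (by simpa using hηb) hwb
  have hφc : HasCompactSupport fun x => η x * w x := hηc.mul_right
  have hφs : tsupport (fun x => η x * w x) ⊆ ball y (2 * r) :=
    (tsupport_mul_subset_left).trans hηs
  have hcap : pCap n p (F ∩ closedBall y r) (ball y (2 * r)) ≤
      ∫ x in ball y (2 * r), ‖fderiv ℝ (fun x => η x * w x) x‖ ^ p := by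
    refine csInf_le (bddBelow_pCap_set n p _ _) ⟨_, ⟨_, hφL⟩, hφc, hφs, ?_, rfl⟩
    rintro x ⟨hxF, hxr⟩
    simp [hη1 x hxr, hw, hF x hxF, hm]
  have hgrad : ∀ᵐ x : EuclideanSpace ℝ (Fin n),
      ‖m‖ₑ * ‖fderiv ℝ (fun x => η x * w x) x‖ₑ ≤
        ‖fderiv ℝ u x‖ₑ + ENNReal.ofReal (2 / r) * ‖u x - m‖ₑ := by
    filter_upwards [hu.ae_differentiableAt, hηL.ae_differentiableAt] with x hux hηx
    have hder : HasFDerivAt w (m⁻¹ • -fderiv ℝ u x) x :=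
      (hux.hasFDerivAt.const_sub m).const_mul m⁻¹
    have hnorm : ‖m‖ * ‖fderiv ℝ (fun x => η x * w x) x‖ ≤
        ‖fderiv ℝ u x‖ + 2 / r * ‖u x - m‖ := by
      have hprod : HasFDerivAt (fun x => η x * w x)
          (η x • (m⁻¹ • -fderiv ℝ u x) + w x • fderiv ℝ η x) x := hηx.hasFDerivAt.mul hder
      rw [hprod.fderiv]
      have hηd : ‖fderiv ℝ η x‖ ≤ 2 / r := by
        simpa [Real.coe_toNNReal _ (show 0 ≤ 2 / r by positivity)] using
          norm_fderiv_le_of_lipschitz ℝ hηL (x₀ := x)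
      have hm' : 0 < ‖m‖ := norm_pos_iff.2 hm
      calc _ ≤ ‖m‖ * (‖η x‖ * (‖m⁻¹‖ * ‖fderiv ℝ u x‖) + ‖w x‖ * ‖fderiv ℝ η x‖) := by
            gcongr
            refine (norm_add_le _ _).trans ?_
            simp only [norm_smul, norm_neg, le_refl]
        _ ≤ ‖m‖ * (1 * (‖m⁻¹‖ * ‖fderiv ℝ u x‖) + ‖w x‖ * (2 / r)) := by
            gcongr
            exact hηb x
        _ = _ := by
            rw [hw, norm_mul, norm_inv, norm_sub_rev]
            field_simp
    have h := ENNReal.ofReal_le_ofReal hnorm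
    rwa [ENNReal.ofReal_mul (norm_nonneg _), ENNReal.ofReal_add (norm_nonneg _) (by positivity),
      ENNReal.ofReal_mul (by positivity), ofReal_norm, ofReal_norm, ofReal_norm, ofReal_norm] at h
  have hum : Measurable fun x => ‖u x - m‖ₑ ^ p :=
    ((hu.continuous.measurable.sub_const m).enorm).pow_const p
  calc _ ≤ ‖m‖ₑ ^ p * ∫⁻ x in ball y (2 * r), ‖fderiv ℝ (fun x => η x * w x) x‖ₑ ^ p := by
        rw [← hφL.ofReal_integral_norm_fderiv_rpow volume hφc hp0]
        gcongr
    _ = ∫⁻ x in ball y (2 * r), (‖m‖ₑ * ‖fderiv ℝ (fun x => η x * w x) x‖ₑ) ^ p := by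
        simp_rw [ENNReal.mul_rpow_of_nonneg _ _ hp0.le]
        rw [lintegral_const_mul' _ _ (by simp [hp0.le])]
    _ ≤ ∫⁻ x in ball y (2 * r), 2 ^ p *
          (‖fderiv ℝ u x‖ₑ ^ p + ENNReal.ofReal (2 / r) ^ p * ‖u x - m‖ₑ ^ p) := by
        refine lintegral_mono_ae (ae_restrict_of_ae ?_)
        filter_upwards [hgrad] with x hx
        calc _ ≤ (‖fderiv ℝ u x‖ₑ + ENNReal.ofReal (2 / r) * ‖u x - m‖ₑ) ^ p := by gcongr
          _ ≤ 2 ^ (p - 1) * (‖fderiv ℝ u x‖ₑ ^ p + (ENNReal.ofReal (2 / r) * ‖u x - m‖ₑ) ^ p) :=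
              ENNReal.rpow_add_le_mul_rpow_add_rpow _ _ hp
          _ ≤ _ := by
              rw [ENNReal.mul_rpow_of_nonneg _ _ hp0.le]
              gcongr
              · exact one_le_two
              · linarith
    _ = _ := by
        rw [lintegral_const_mul' _ _ (by simp), lintegral_add_right _ (hum.const_mul _),
          lintegral_const_mul _ hum]

/-- Capacitary Poincaré inequality at boundary points of a uniformly `p`-fat set: a Lipschitz
function vanishing on `F` is controlled on balls centred at `frontier F` by its gradient. -/
theorem UniformlyFat.exists_lintegral_ball_le {n : ℕ} (hn : 0 < n) {p c₀ r₀ : ℝ} (hp : 1 ≤ p)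
    (hc₀ : 0 < c₀) {F : Set (EuclideanSpace ℝ (Fin n))} (hfat : UniformlyFat n p c₀ r₀ F) :
    ∃ C : ℝ≥0∞, C ≠ ∞ ∧ ∀ y ∈ frontier F, ∀ r : ℝ, 0 < r → r ≤ r₀ →
      ∀ (u : EuclideanSpace ℝ (Fin n) → ℝ) (L : ℝ≥0), LipschitzWith L u → HasCompactSupport u →
        (∀ x ∈ F, u x = 0) →
        ∫⁻ x in ball y (2 * r), ‖u x‖ₑ ^ p ≤
          C * ENNReal.ofReal r ^ p * ∫⁻ x in ball y (2 * r), ‖fderiv ℝ u x‖ₑ ^ p := by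
  have hp0 : 0 < p := by linarith
  have : Nontrivial (EuclideanSpace ℝ (Fin n)) :=
    Module.nontrivial_of_finrank_pos (R := ℝ) (by simpa using hn)
  obtain ⟨c, hc, hcap⟩ := exists_mul_rpow_le_pCap_closedBall n hn hp
  set ω : ℝ≥0∞ := volume (ball (0 : EuclideanSpace ℝ (Fin n)) 1) with hω
  have hωfin : ω ≠ ∞ := measure_ball_lt_top.ne
  set A : ℝ≥0∞ := 2 ^ p * (1 + 8 ^ p * 2 ^ n) with hA
  have hpow : ∀ k : ℕ, ((k : ℝ≥0∞) ^ p) ≠ ∞ := fun k => by simp [hp0.le]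
  refine ⟨2 ^ p * (4 ^ p * 2 ^ n + A * (ENNReal.ofReal (2 ^ n / (c₀ * c)) * ω)), ?_, ?_⟩
  · have h2 := hpow 2
    have h4 := hpow 4
    have h8 := hpow 8
    push_cast at h2 h4 h8
    finiteness
  intro y hy r hr hr₀ u L hu huc huF
  set D : ℝ≥0∞ := ∫⁻ x in ball y (2 * r), ‖fderiv ℝ u x‖ₑ ^ p with hD
  obtain ⟨m, hm⟩ := hu.exists_lintegral_ball_enorm_sub_rpow_le volume hp y (R := 2 * r)
    (by positivity)
  rw [finrank_euclideanSpace_fin, ← hD,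
    show ENNReal.ofReal (2 * (2 * r)) ^ p = 4 ^ p * ENNReal.ofReal r ^ p by
      rw [← mul_assoc, ENNReal.ofReal_mul (by norm_num), ENNReal.mul_rpow_of_nonneg _ _ hp0.le]
      norm_num] at hm
  have hmean : ‖m‖ₑ ^ p * ENNReal.ofReal (c₀ * c * r ^ (n - p)) ≤ A * D := by
    calc _ ≤ ‖m‖ₑ ^ p * ENNReal.ofReal (pCap n p (F ∩ closedBall y r) (ball y (2 * r))) := by
          gcongr
          refine le_trans ?_ (hfat y hy r hr hr₀)
          rw [mul_assoc]
          gcongr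
          exact hcap y r hr
      _ ≤ 2 ^ p * (D + ENNReal.ofReal (2 / r) ^ p * ∫⁻ x in ball y (2 * r), ‖u x - m‖ₑ ^ p) :=
          pCap_le_of_eq_zero_on hp hu huc huF y hr m
      _ ≤ 2 ^ p * (D + ENNReal.ofReal (2 / r) ^ p *
            (4 ^ p * ENNReal.ofReal r ^ p * (2 ^ n * D))) := by gcongr
      _ = 2 ^ p * (D + (ENNReal.ofReal (2 / r) * 4 * ENNReal.ofReal r) ^ p * (2 ^ n * D)) := by
          simp only [ENNReal.mul_rpow_of_nonneg _ _ hp0.le, mul_assoc]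
      _ = A * D := by
          rw [show ENNReal.ofReal (2 / r) * 4 * ENNReal.ofReal r = 8 by
            rw [← ENNReal.ofReal_ofNat, ← ENNReal.ofReal_mul (by positivity),
              ← ENNReal.ofReal_mul (by positivity), ← ENNReal.ofReal_ofNat]
            congr 1
            field_simp
            norm_num]
          ring
  have hvol : volume (ball y (2 * r)) = ENNReal.ofReal (c₀ * c * r ^ (n - p)) *
      (ENNReal.ofReal (2 ^ n / (c₀ * c)) * ω * ENNReal.ofReal r ^ p) := by
    rw [Measure.addHaar_ball volume y (by positivity), finrank_euclideanSpace_fin, ← hω,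
      ENNReal.ofReal_rpow_of_pos hr]
    rw [show ∀ a b d : ℝ≥0∞, a * (b * ω * d) = a * b * d * ω by intros; ring,
      ← ENNReal.ofReal_mul (by positivity), ← ENNReal.ofReal_mul (by positivity)]
    congr 2
    rw [Real.rpow_sub hr, Real.rpow_natCast, mul_pow]
    field_simp
  have hmvol : ‖m‖ₑ ^ p * volume (ball y (2 * r)) ≤
      A * (ENNReal.ofReal (2 ^ n / (c₀ * c)) * ω) * ENNReal.ofReal r ^ p * D := by
    rw [hvol, ← mul_assoc]
    calc _ ≤ A * D * (ENNReal.ofReal (2 ^ n / (c₀ * c)) * ω * ENNReal.ofReal r ^ p) := by gcongr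
      _ = _ := by ring
  calc _ ≤ ∫⁻ x in ball y (2 * r), 2 ^ p * (‖u x - m‖ₑ ^ p + ‖m‖ₑ ^ p) := by
        refine lintegral_mono fun x => ?_
        calc ‖u x‖ₑ ^ p ≤ (‖u x - m‖ₑ + ‖m‖ₑ) ^ p := by
              gcongr
              simpa using enorm_add_le (u x - m) m
          _ ≤ 2 ^ (p - 1) * (‖u x - m‖ₑ ^ p + ‖m‖ₑ ^ p) :=
              ENNReal.rpow_add_le_mul_rpow_add_rpow _ _ hp
          _ ≤ _ := by
              gcongr
              · exact one_le_two
              · linarith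
    _ = 2 ^ p * ((∫⁻ x in ball y (2 * r), ‖u x - m‖ₑ ^ p) +
          ‖m‖ₑ ^ p * volume (ball y (2 * r))) := by
        rw [lintegral_const_mul' _ _ (by simp), lintegral_add_right _ measurable_const,
          lintegral_const, Measure.restrict_apply_univ]
    _ ≤ 2 ^ p * (4 ^ p * ENNReal.ofReal r ^ p * (2 ^ n * D) +
          A * (ENNReal.ofReal (2 ^ n / (c₀ * c)) * ω) * ENNReal.ofReal r ^ p * D) := by gcongr
    _ = _ := by ring

end Capacity

section Layers

variable {E : Type*} [NormedAddCommGroup E] [NormedSpace ℝ E] [FiniteDimensional ℝ E]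
  [MeasurableSpace E] [BorelSpace E] (μ : Measure E) [μ.IsAddHaarMeasure]

theorem lintegral_lintegral_ball_comm {f : E → ℝ≥0∞} (hf : Measurable f) (S : Set E)
    (t : ℝ) :
    ∫⁻ x in S, ∫⁻ z in ball x t, f z ∂μ ∂μ = ∫⁻ z, f z * μ (S ∩ ball z t) ∂μ := by
  have hT : MeasurableSet {q : E × E | dist q.2 q.1 < t} :=
    measurableSet_lt (by fun_prop) measurable_const
  calc _ = ∫⁻ x in S, ∫⁻ z, {q : E × E | dist q.2 q.1 < t}.indicator (fun q => f q.2) (x, z)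
        ∂μ ∂μ := by
        congr 1
        funext x
        rw [← lintegral_indicator measurableSet_ball]
        rfl
    _ = ∫⁻ z, ∫⁻ x in S, {q : E × E | dist q.2 q.1 < t}.indicator (fun q => f q.2) (x, z)
        ∂μ ∂μ := by
        rw [lintegral_lintegral_swap]
        exact ((hf.comp measurable_snd).indicator hT).aemeasurable
    _ = _ := by
        congr 1
        funext z
        have : ∀ x, {q : E × E | dist q.2 q.1 < t}.indicator (fun q => f q.2) (x, z) =
            (ball z t).indicator (fun _ => f z) x := by
          intro x
          simp [Set.indicator, dist_comm]
        simp_rw [this]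
        rw [lintegral_indicator measurableSet_ball, lintegral_const, Measure.restrict_apply_univ,
          Measure.restrict_apply measurableSet_ball, Set.inter_comm]

theorem setLIntegral_infDist_le_of_ball_le {f g : E → ℝ≥0∞} (hf : Measurable f)
    (hg : Measurable g) (F : Set E) {t : ℝ} (ht : 0 < t) (M : ℝ≥0∞)
    (h : ∀ x, infDist x F < 2 * t →
      ∫⁻ z in ball x t, f z ∂μ ≤ M * ∫⁻ z in ball x (6 * t), g z ∂μ) :
    ∫⁻ z in {z | infDist z F ≤ t}, f z ∂μ ≤
      6 ^ Module.finrank ℝ E * M * ∫⁻ z in {z | infDist z F < 8 * t}, g z ∂μ := by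
  have hδ : Measurable fun z : E => infDist z F := measurable_infDist
  have hS : MeasurableSet {z : E | infDist z F < 2 * t} := measurableSet_lt hδ measurable_const
  have hs : MeasurableSet {z : E | infDist z F ≤ t} := measurableSet_le hδ measurable_const
  have hS' : MeasurableSet {z : E | infDist z F < 8 * t} := measurableSet_lt hδ measurable_const
  set β : ℝ≥0∞ := μ (ball (0 : E) t) with hβ
  have hβ0 : β ≠ 0 := (measure_ball_pos μ _ ht).ne'
  have hβ1 : β ≠ ∞ := measure_ball_lt_top.ne
  have hlow : β * ∫⁻ z in {z | infDist z F ≤ t}, f z ∂μ ≤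
      ∫⁻ x in {z | infDist z F < 2 * t}, ∫⁻ z in ball x t, f z ∂μ ∂μ := by
    rw [lintegral_lintegral_ball_comm μ hf, ← lintegral_const_mul _ hf,
      ← lintegral_indicator hs]
    refine lintegral_mono fun z => ?_
    by_cases hz : z ∈ {z | infDist z F ≤ t}
    swap
    · rw [Set.indicator_of_notMem hz]
      exact zero_le
    rw [Set.indicator_of_mem hz, mul_comm]
    gcongr
    rw [hβ, ← Measure.addHaar_ball_center μ z]
    refine measure_mono fun x hx => ⟨?_, hx⟩
    have h1 : infDist x F ≤ infDist z F + dist x z := infDist_le_infDist_add_dist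
    have h2 : infDist z F ≤ t := hz
    have h3 := mem_ball.1 hx
    change infDist x F < 2 * t
    linarith
  have hupp : ∫⁻ x in {z | infDist z F < 2 * t}, ∫⁻ z in ball x (6 * t), g z ∂μ ∂μ ≤
      6 ^ Module.finrank ℝ E * β * ∫⁻ z in {z | infDist z F < 8 * t}, g z ∂μ := by
    rw [lintegral_lintegral_ball_comm μ hg, ← lintegral_const_mul _ hg,
      ← lintegral_indicator hS']
    refine lintegral_mono fun z => ?_
    by_cases hz : z ∈ {z | infDist z F < 8 * t}
    · rw [Set.indicator_of_mem hz, mul_comm]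
      gcongr
      calc _ ≤ μ (ball z (6 * t)) := measure_mono Set.inter_subset_right
        _ = _ := by
          rw [Measure.addHaar_ball_mul_of_pos μ z (by norm_num), ← hβ,
            ENNReal.ofReal_pow (by norm_num), ENNReal.ofReal_ofNat]
    · rw [Set.indicator_of_notMem hz]
      have : {z | infDist z F < 2 * t} ∩ ball z (6 * t) = ∅ := by
        refine Set.eq_empty_of_forall_notMem fun x hx => hz ?_
        have h1 : infDist z F ≤ infDist x F + dist z x := infDist_le_infDist_add_dist
        have h2 : infDist x F < 2 * t := hx.1
        have h3 := mem_ball'.1 hx.2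
        change infDist z F < 8 * t
        linarith
      simp [this]
  refine (ENNReal.mul_le_mul_iff_right hβ0 hβ1).1 ?_
  calc _ ≤ _ := hlow
    _ ≤ ∫⁻ x in {z | infDist z F < 2 * t}, M * ∫⁻ z in ball x (6 * t), g z ∂μ ∂μ :=
        setLIntegral_mono_ae' hS (ae_of_all _ h)
    _ = M * ∫⁻ x in {z | infDist z F < 2 * t}, ∫⁻ z in ball x (6 * t), g z ∂μ ∂μ := by
        refine lintegral_const_mul _ ?_
        have hT : MeasurableSet {q : E × E | dist q.2 q.1 < 6 * t} :=
          measurableSet_lt (by fun_prop) measurable_const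
        have : ∀ x, ∫⁻ z in ball x (6 * t), g z ∂μ =
            ∫⁻ z, {q : E × E | dist q.2 q.1 < 6 * t}.indicator (fun q => g q.2) (x, z) ∂μ := by
          intro x
          rw [← lintegral_indicator measurableSet_ball]
          rfl
        simp_rw [this]
        exact Measurable.lintegral_prod_right' ((hg.comp measurable_snd).indicator hT)
    _ ≤ M * (6 ^ Module.finrank ℝ E * β * ∫⁻ z in {z | infDist z F < 8 * t}, g z ∂μ) := by gcongr
    _ = _ := by ring

theorem lintegral_Ioi_rpow_neg_sub_one {a q : ℝ} (ha : 0 < a) (hq : 0 < q) :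
    ∫⁻ t in Set.Ioi a, ENNReal.ofReal (t ^ (-q - 1)) = ENNReal.ofReal (a ^ (-q) / q) := by
  rw [← ofReal_integral_eq_lintegral_ofReal (integrableOn_Ioi_rpow_of_lt (by linarith) ha),
    integral_Ioi_rpow_of_lt (by linarith) ha]
  · congr 1
    rw [sub_add_cancel, neg_div_neg_eq]
  · filter_upwards [ae_restrict_mem measurableSet_Ioi] with t ht
    exact Real.rpow_nonneg (ha.le.trans (le_of_lt ht)) _

theorem lintegral_mul_rpow_le_of_sublevel_le {X : Type*} [MeasurableSpace X] (ν : Measure X)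
    [SFinite ν] {W G : X → ℝ≥0∞} {δ : X → ℝ} (hW : Measurable W) (hG : Measurable G)
    (hδ : Measurable δ) (hδ0 : ∀ x, 0 ≤ δ x) (hG0 : ∀ x, δ x = 0 → G x = 0) {p A : ℝ} (hp : 0 < p)
    (hA : 1 ≤ A) {C : ℝ≥0∞}
    (h : ∀ t : ℝ, 0 < t → ∫⁻ x in {x | δ x ≤ t}, W x ∂ν ≤
      C * ENNReal.ofReal (t ^ p) * ∫⁻ x in {x | δ x < A * t}, G x ∂ν)
    {s : ℝ} (hs : 0 < s) (hs1 : s ≤ 1) :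
    ∫⁻ x, W x * ENNReal.ofReal (δ x ^ (-(p + s))) ∂ν ≤
      C * ENNReal.ofReal ((p + 1) * A / s) * ∫⁻ x, G x * ENNReal.ofReal (δ x ^ (-s)) ∂ν := by
  have hκ : ∀ q : ℝ, Measurable fun t : ℝ => ENNReal.ofReal (t ^ q) := fun q => by fun_prop
  have hps : 0 < p + s := by linarith
  have hA0 : 0 < A := by linarith
  have hset : ∀ t, MeasurableSet {x | δ x ≤ t} := fun t => measurableSet_le hδ measurable_const
  have hset' : ∀ t, MeasurableSet {x | δ x < A * t} := fun t => measurableSet_lt hδ measurable_const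
  have hT : MeasurableSet {q : X × ℝ | δ q.1 ≤ q.2} :=
    measurableSet_le (hδ.comp measurable_fst) measurable_snd
  have hT' : MeasurableSet {q : X × ℝ | δ q.1 < A * q.2} :=
    measurableSet_lt (hδ.comp measurable_fst) (by fun_prop)
  have hleft : ∀ x, ENNReal.ofReal (δ x ^ (-(p + s))) ≤ ENNReal.ofReal (p + s) *
      ∫⁻ t in Set.Ioi (0 : ℝ), {q : X × ℝ | δ q.1 ≤ q.2}.indicator
        (fun q => ENNReal.ofReal (q.2 ^ (-(p + s) - 1))) (x, t) := by
    intro x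
    rcases (hδ0 x).eq_or_lt with h0 | h0
    · rw [← h0, Real.zero_rpow (by linarith)]
      simp
    calc _ = ENNReal.ofReal (p + s) *
          ∫⁻ t in Set.Ioi (δ x), ENNReal.ofReal (t ^ (-(p + s) - 1)) := by
          rw [lintegral_Ioi_rpow_neg_sub_one h0 hps, ← ENNReal.ofReal_mul hps.le,
            mul_div_cancel₀ _ hps.ne']
      _ ≤ _ := by
          gcongr ENNReal.ofReal (p + s) * ?_
          rw [← lintegral_indicator measurableSet_Ioi, ← lintegral_indicator measurableSet_Ioi]
          refine lintegral_mono fun t => ?_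
          by_cases ht : t ∈ Set.Ioi (δ x)
          swap
          · rw [Set.indicator_of_notMem ht]
            exact zero_le
          have ht' : δ x < t := ht
          rw [Set.indicator_of_mem ht, Set.indicator_of_mem (show t ∈ Set.Ioi 0 from h0.trans ht'),
            Set.indicator_of_mem (show (x, t) ∈ {q : X × ℝ | δ q.1 ≤ q.2} from ht'.le)]
  have hright : ∀ x, G x * ∫⁻ t in Set.Ioi (0 : ℝ), {q : X × ℝ | δ q.1 < A * q.2}.indicator
        (fun q => ENNReal.ofReal (q.2 ^ (-s - 1))) (x, t) ≤
      ENNReal.ofReal (A / s) * (G x * ENNReal.ofReal (δ x ^ (-s))) := by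
    intro x
    rcases (hδ0 x).eq_or_lt with h0 | h0
    · simp [hG0 x h0.symm]
    rw [mul_left_comm]
    gcongr G x * ?_
    calc _ ≤ ∫⁻ t in Set.Ioi (δ x / A), ENNReal.ofReal (t ^ (-s - 1)) := by
          rw [← lintegral_indicator measurableSet_Ioi, ← lintegral_indicator measurableSet_Ioi]
          refine lintegral_mono fun t => ?_
          have hiff : (x, t) ∈ {q : X × ℝ | δ q.1 < A * q.2} ↔ t ∈ Set.Ioi (δ x / A) :=
            (div_lt_iff₀' hA0).symm
          by_cases ht : t ∈ Set.Ioi (δ x / A)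
          · rw [Set.indicator_of_mem ht]
            exact (Set.indicator_le_self' (fun _ _ => zero_le) t).trans
              (Set.indicator_le_self' (fun _ _ => zero_le) (x, t))
          · refine (Set.indicator_le_self' (fun _ _ => zero_le) t).trans ?_
            rw [Set.indicator_of_notMem (mt hiff.1 ht)]
            exact zero_le
      _ = ENNReal.ofReal (A ^ s / s * δ x ^ (-s)) := by
          rw [lintegral_Ioi_rpow_neg_sub_one (by positivity) hs, Real.div_rpow h0.le hA0.le,
            Real.rpow_neg hA0.le, div_inv_eq_mul]
          congr 1
          ring
      _ ≤ _ := by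
          rw [ENNReal.ofReal_mul (by positivity)]
          gcongr
          exact Real.rpow_le_self_of_one_le hA hs1
  calc _ ≤ ∫⁻ x, ENNReal.ofReal (p + s) * ∫⁻ t in Set.Ioi (0 : ℝ), W x *
        {q : X × ℝ | δ q.1 ≤ q.2}.indicator
          (fun q => ENNReal.ofReal (q.2 ^ (-(p + s) - 1))) (x, t) ∂volume ∂ν := by
        refine lintegral_mono fun x => ?_
        rw [lintegral_const_mul _ (by
          exact (((hκ _).comp measurable_snd).indicator hT).comp measurable_prodMk_left),
          mul_left_comm]
        gcongr
        exact hleft x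
    _ = ENNReal.ofReal (p + s) * ∫⁻ t in Set.Ioi (0 : ℝ), ∫⁻ x, W x *
        {q : X × ℝ | δ q.1 ≤ q.2}.indicator
          (fun q => ENNReal.ofReal (q.2 ^ (-(p + s) - 1))) (x, t) ∂ν := by
        rw [lintegral_const_mul' _ _ ENNReal.ofReal_ne_top, lintegral_lintegral_swap]
        exact ((hW.comp measurable_fst).mul
          (((hκ _).comp measurable_snd).indicator hT)).aemeasurable
    _ ≤ ENNReal.ofReal (p + s) * ∫⁻ t in Set.Ioi (0 : ℝ), C * ∫⁻ x, G x *
        {q : X × ℝ | δ q.1 < A * q.2}.indicator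
          (fun q => ENNReal.ofReal (q.2 ^ (-s - 1))) (x, t) ∂ν := by
        gcongr ENNReal.ofReal (p + s) * ?_
        refine setLIntegral_mono_ae' measurableSet_Ioi (ae_of_all _ fun t ht => ?_)
        have ht0 : 0 < t := ht
        calc _ = ENNReal.ofReal (t ^ (-(p + s) - 1)) * ∫⁻ x in {x | δ x ≤ t}, W x ∂ν := by
              rw [← lintegral_indicator (hset t), ← lintegral_const_mul _ (hW.indicator (hset t))]
              congr 1
              funext x
              by_cases hx : δ x ≤ t <;> simp [Set.indicator, hx, mul_comm]
          _ ≤ ENNReal.ofReal (t ^ (-(p + s) - 1)) *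
                (C * ENNReal.ofReal (t ^ p) * ∫⁻ x in {x | δ x < A * t}, G x ∂ν) := by
              gcongr
              exact h t ht0
          _ = C * (ENNReal.ofReal (t ^ (-s - 1)) * ∫⁻ x in {x | δ x < A * t}, G x ∂ν) := by
              rw [show -s - 1 = -(p + s) - 1 + p by ring, Real.rpow_add ht0,
                ENNReal.ofReal_mul (by positivity)]
              ring
          _ = _ := by
              congr 1
              rw [← lintegral_indicator (hset' t),
                ← lintegral_const_mul _ (hG.indicator (hset' t))]
              congr 1
              funext x
              by_cases hx : δ x < A * t <;> simp [Set.indicator, hx, mul_comm]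
    _ = ENNReal.ofReal (p + s) * (C * ∫⁻ x, G x * ∫⁻ t in Set.Ioi (0 : ℝ),
        {q : X × ℝ | δ q.1 < A * q.2}.indicator
          (fun q => ENNReal.ofReal (q.2 ^ (-s - 1))) (x, t) ∂volume ∂ν) := by
        have hm : Measurable fun q : X × ℝ => G q.1 * {q : X × ℝ | δ q.1 < A * q.2}.indicator
            (fun q => ENNReal.ofReal (q.2 ^ (-s - 1))) q :=
          (hG.comp measurable_fst).mul (((hκ _).comp measurable_snd).indicator hT')
        rw [lintegral_const_mul _ (Measurable.lintegral_prod_left' hm),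
          lintegral_lintegral_swap (by exact (hm.comp measurable_swap).aemeasurable)]
        congr 3
        funext x
        have hx : Measurable fun t : ℝ => {q : X × ℝ | δ q.1 < A * q.2}.indicator
            (fun q => ENNReal.ofReal (q.2 ^ (-s - 1))) (x, t) :=
          (((hκ _).comp measurable_snd).indicator hT').comp measurable_prodMk_left
        exact lintegral_const_mul (G x) hx
    _ ≤ ENNReal.ofReal (p + 1) * (C * ∫⁻ x, ENNReal.ofReal (A / s) *
          (G x * ENNReal.ofReal (δ x ^ (-s))) ∂ν) := by
        gcongr ENNReal.ofReal ?_ * (C * ?_)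
        · linarith
        · exact lintegral_mono hright
    _ = _ := by
        rw [lintegral_const_mul' _ _ ENNReal.ofReal_ne_top, mul_div_assoc (p + 1) A s,
          ENNReal.ofReal_mul (by linarith)]
        ring

end Layers

section Hardy

/-- Poincaré inequality near the boundary: the mass of `u` at distance at most `t` from the boundary
is controlled by `t ^ p` times the energy of `u` at distance less than `A * t`. -/
theorem UniformlyFat.exists_sublevel_le {n : ℕ} (hn : 0 < n) {p : ℝ} (hp : 1 ≤ p)
    {c₀ r₀ : ℝ} (hc₀ : 0 < c₀) (hr₀ : 0 < r₀) {Ω : Set (EuclideanSpace ℝ (Fin n))}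
    (hb : Bornology.IsBounded Ω) (hne : (frontier Ω).Nonempty) (hfat : UniformlyFat n p c₀ r₀ Ωᶜ) :
    ∃ C : ℝ≥0∞, C ≠ ∞ ∧ ∃ A : ℝ, 1 ≤ A ∧
      ∀ (u : EuclideanSpace ℝ (Fin n) → ℝ) (L : ℝ≥0), LipschitzWith L u → HasCompactSupport u →
        tsupport u ⊆ Ω → ∀ t : ℝ, 0 < t →
        ∫⁻ x in {x | infDist x (frontier Ω) ≤ t}, ‖u x‖ₑ ^ p ≤
          C * ENNReal.ofReal (t ^ p) *
            ∫⁻ x in {x | infDist x (frontier Ω) < A * t}, ‖fderiv ℝ u x‖ₑ ^ p := by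
  have hp0 : 0 < p := by linarith
  have : Nontrivial (EuclideanSpace ℝ (Fin n)) :=
    Module.nontrivial_of_finrank_pos (R := ℝ) (by simpa using hn)
  obtain ⟨C₁, hC₁, h₁⟩ := hfat.exists_lintegral_ball_le hn hp hc₀
  obtain ⟨y₀, hy₀⟩ := hne
  obtain ⟨R, hR, hΩR⟩ := hb.subset_ball_lt 0 y₀
  refine ⟨6 ^ n * (C₁ * 2 ^ p) + ENNReal.ofReal (8 * R / r₀) ^ p * 4 ^ n, by finiteness,
    max 8 (2 * R / r₀), (by norm_num : (1 : ℝ) ≤ 8).trans (le_max_left _ _),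
    fun u L hu huc hus t ht => ?_⟩
  have htp : ENNReal.ofReal (t ^ p) = ENNReal.ofReal t ^ p :=
    (ENNReal.ofReal_rpow_of_pos ht).symm
  rcases le_or_gt (2 * t) r₀ with htr | htr
  · have h := setLIntegral_infDist_le_of_ball_le (volume : Measure (EuclideanSpace ℝ (Fin n)))
      (f := fun x => ‖u x‖ₑ ^ p) (g := fun x => ‖fderiv ℝ u x‖ₑ ^ p)
      (hu.continuous.measurable.enorm.pow_const p) ((measurable_fderiv ℝ u).enorm.pow_const p)
      (frontier Ω) ht (C₁ * ENNReal.ofReal (2 * t) ^ p) fun x hx => by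
        obtain ⟨y, hy, hxy⟩ := (infDist_lt_iff ⟨y₀, hy₀⟩).1 hx
        have := h₁ y (by rwa [frontier_compl]) (2 * t) (by positivity) htr u L hu huc
          fun z hz => image_eq_zero_of_notMem_tsupport fun h => hz (hus h)
        refine (lintegral_mono_set (ball_subset_ball' ?_)).trans (this.trans ?_)
        · linarith
        · gcongr
          refine ball_subset_ball' ?_
          rw [dist_comm]
          linarith
    refine h.trans ?_
    refine mul_le_mul' ?_ (lintegral_mono_set fun z hz => hz.out.trans_le ?_)
    · rw [finrank_euclideanSpace_fin, htp, ENNReal.ofReal_mul zero_le_two, ENNReal.ofReal_ofNat,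
        ENNReal.mul_rpow_of_nonneg _ _ hp0.le, ← mul_assoc C₁, ← mul_assoc (6 ^ n)]
      gcongr
      exact le_self_add
    · gcongr
      exact le_max_left _ _
  · have hsub : tsupport u ⊆ {x | infDist x (frontier Ω) < max 8 (2 * R / r₀) * t} := by
      intro x hx
      calc infDist x (frontier Ω) ≤ dist x y₀ := infDist_le_dist_of_mem hy₀
        _ < R := hΩR (hus hx)
        _ ≤ 2 * R / r₀ * t := by
          rw [div_mul_eq_mul_div, le_div_iff₀ hr₀]
          nlinarith
        _ ≤ _ := by gcongr; exact le_max_right _ _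
    rw [setLIntegral_enorm_fderiv_rpow_eq _ hp0 hsub]
    refine (setLIntegral_le_lintegral _ _).trans ?_
    refine (hu.lintegral_enorm_rpow_le_of_support_subset_ball volume hp y₀ hR fun x hx =>
      image_eq_zero_of_notMem_tsupport fun h => hx (hΩR (hus h))).trans ?_
    rw [← mul_assoc]
    refine mul_le_mul_left ?_ _
    rw [finrank_euclideanSpace_fin, htp]
    calc ENNReal.ofReal (4 * R) ^ p * 4 ^ n
        ≤ (ENNReal.ofReal (8 * R / r₀) * ENNReal.ofReal t) ^ p * 4 ^ n := by
          gcongr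
          rw [← ENNReal.ofReal_mul (by positivity)]
          refine ENNReal.ofReal_le_ofReal ?_
          rw [div_mul_eq_mul_div, le_div_iff₀ hr₀]
          nlinarith
      _ = ENNReal.ofReal (8 * R / r₀) ^ p * 4 ^ n * ENNReal.ofReal t ^ p := by
          rw [ENNReal.mul_rpow_of_nonneg _ _ hp0.le]
          ring
      _ ≤ _ := by
          gcongr
          exact le_add_self

theorem LipschitzWith.exists_lipschitzWith_mul_infDist_rpow {X : Type*} [PseudoMetricSpace X]
    {φ : X → ℝ} {K : ℝ≥0} (hφ : LipschitzWith K φ) (hc : HasCompactSupport φ) {F : Set X}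
    (hpos : ∀ x ∈ tsupport φ, 0 < infDist x F) (q : ℝ) :
    ∃ L, LipschitzWith L fun x => φ x * infDist x F ^ q := by
  obtain ⟨d, hd, hdle⟩ := hc.isCompact.exists_forall_le' (continuous_infDist_pt F).continuousOn hpos
  obtain ⟨D, hD⟩ := hc.isCompact.bddAbove_image (continuous_infDist_pt F).continuousOn
  have hsmooth : ContDiffOn ℝ 1 (fun t : ℝ => t ^ q) (Set.Icc d (max d D)) := fun t ht =>
    (Real.contDiffAt_rpow_const_of_ne (hd.trans_le ht.1).ne').contDiffWithinAt
  obtain ⟨M, hM⟩ := hsmooth.exists_lipschitzOnWith one_ne_zero (convex_Icc _ _) isCompact_Icc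
  obtain ⟨B, hB⟩ := isCompact_Icc.exists_bound_of_continuousOn hsmooth.continuousOn
  obtain ⟨A, hA⟩ := hc.exists_bound_of_continuous hφ.continuous
  have hmem : ∀ x, max d (min (max d D) (infDist x F)) ∈ Set.Icc d (max d D) := fun x =>
    ⟨le_max_left _ _, max_le (le_max_left _ _) (min_le_left _ _)⟩
  have hclamp : LipschitzWith 1 fun x => max d (min (max d D) (infDist x F)) :=
    ((lipschitz_infDist_pt F).const_min _).const_max _
  have hw : LipschitzWith (M * 1) fun x => (max d (min (max d D) (infDist x F))) ^ q :=
    lipschitzOnWith_univ.1 (hM.comp hclamp.lipschitzOnWith fun x _ => hmem x)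
  refine ⟨A.toNNReal * (M * 1) + B.toNNReal * K, ?_⟩
  convert hφ.mul_of_bounded hw (A := A.toNNReal) (B := B.toNNReal)
    (fun x => (hA x).trans (Real.le_coe_toNNReal A))
    (fun x => (hB _ (hmem x)).trans (Real.le_coe_toNNReal B)) using 2 with x
  by_cases hx : x ∈ tsupport φ
  · rw [min_eq_right ((hD (Set.mem_image_of_mem _ hx)).trans (le_max_right _ _)),
      max_eq_right (hdle x hx)]
  · simp [image_eq_zero_of_notMem_tsupport hx]

section

variable {E : Type*} [NormedAddCommGroup E] [NormedSpace ℝ E]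

theorem enorm_fderiv_mul_infDist_rpow_le {φ : E → ℝ} (hφ : Differentiable ℝ φ) {F : Set E}
    (hpos : ∀ x ∈ tsupport φ, 0 < infDist x F) {q : ℝ} (hq : 0 < q) {x : E}
    (hx : DifferentiableAt ℝ (fun y => infDist y F) x) :
    ‖fderiv ℝ (fun y => φ y * infDist y F ^ q) x‖ₑ ≤
      ENNReal.ofReal (infDist x F ^ q) * ‖fderiv ℝ φ x‖ₑ +
        ENNReal.ofReal (q * infDist x F ^ (q - 1)) * ‖φ x‖ₑ := by
  by_cases hxs : x ∈ tsupport φ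
  · have h0 := hpos x hxs
    have h : HasFDerivAt (fun y => φ y * infDist y F ^ q)
        (φ x • ((q * infDist x F ^ (q - 1)) • fderiv ℝ (fun y => infDist y F) x) +
          (infDist x F ^ q) • fderiv ℝ φ x) x :=
      (hφ x).hasFDerivAt.mul (hx.hasFDerivAt.rpow_const (Or.inl h0.ne'))
    have hδ : ‖fderiv ℝ (fun y => infDist y F) x‖ₑ ≤ 1 := by
      rw [← ofReal_norm, ENNReal.ofReal_le_one]
      exact norm_fderiv_le_of_lipschitz ℝ (lipschitz_infDist_pt F)
    rw [h.fderiv, add_comm]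
    refine (enorm_add_le (_ : E →L[ℝ] ℝ) _).trans ?_
    rw [enorm_smul, enorm_smul, enorm_smul, Real.enorm_of_nonneg (Real.rpow_nonneg h0.le _),
      Real.enorm_of_nonneg (by positivity : 0 ≤ q * infDist x F ^ (q - 1))]
    gcongr _ + ?_
    rw [mul_comm]
    gcongr
    exact mul_le_of_le_one_right zero_le hδ
  · have h : (fun y => φ y * infDist y F ^ q) =ᶠ[nhds x] fun _ => 0 := by
      filter_upwards [(isClosed_tsupport φ).isOpen_compl.mem_nhds hxs] with y hy
      rw [image_eq_zero_of_notMem_tsupport hy, zero_mul]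
    rw [h.fderiv_eq]
    simp [← ofReal_norm]

theorem enorm_fderiv_mul_infDist_rpow_rpow_mul_le {φ : E → ℝ} (hφ : Differentiable ℝ φ) {F : Set E}
    (hpos : ∀ x ∈ tsupport φ, 0 < infDist x F) {p s : ℝ} (hp : 1 ≤ p) (hs : 0 < s) {x : E}
    (hx : DifferentiableAt ℝ (fun y => infDist y F) x) (h0 : 0 < infDist x F) :
    ‖fderiv ℝ (fun y => φ y * infDist y F ^ (s / p)) x‖ₑ ^ p *
        ENNReal.ofReal (infDist x F ^ (-s)) ≤
      2 ^ p * (‖fderiv ℝ φ x‖ₑ ^ p +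
        ENNReal.ofReal ((s / p) ^ p) * (‖φ x‖ₑ ^ p * ENNReal.ofReal (infDist x F ^ (-p)))) := by
  have hp0 : 0 < p := by linarith
  have hq : 0 < s / p := by positivity
  set d := infDist x F with hd
  calc _ ≤ (ENNReal.ofReal (d ^ (s / p)) * ‖fderiv ℝ φ x‖ₑ +
        ENNReal.ofReal (s / p * d ^ (s / p - 1)) * ‖φ x‖ₑ) ^ p * ENNReal.ofReal (d ^ (-s)) := by
        gcongr
        exact enorm_fderiv_mul_infDist_rpow_le hφ hpos hq hx
    _ ≤ 2 ^ p * ((ENNReal.ofReal (d ^ (s / p)) * ‖fderiv ℝ φ x‖ₑ) ^ p +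
        (ENNReal.ofReal (s / p * d ^ (s / p - 1)) * ‖φ x‖ₑ) ^ p) * ENNReal.ofReal (d ^ (-s)) := by
        gcongr
        refine (ENNReal.rpow_add_le_mul_rpow_add_rpow _ _ hp).trans ?_
        gcongr
        · norm_num
        · linarith
    _ = 2 ^ p * ((ENNReal.ofReal (d ^ (s / p)) ^ p * ENNReal.ofReal (d ^ (-s))) *
          ‖fderiv ℝ φ x‖ₑ ^ p + (ENNReal.ofReal (s / p * d ^ (s / p - 1)) ^ p *
            ENNReal.ofReal (d ^ (-s))) * ‖φ x‖ₑ ^ p) := by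
        rw [ENNReal.mul_rpow_of_nonneg _ _ hp0.le, ENNReal.mul_rpow_of_nonneg _ _ hp0.le]
        ring
    _ = _ := by
        have h1 : ENNReal.ofReal (d ^ (s / p)) ^ p * ENNReal.ofReal (d ^ (-s)) = 1 := by
          rw [ENNReal.ofReal_rpow_of_nonneg (by positivity) hp0.le,
            ← ENNReal.ofReal_mul (by positivity), ← Real.rpow_mul h0.le, div_mul_cancel₀ _ hp0.ne',
            ← Real.rpow_add h0, add_neg_cancel, Real.rpow_zero, ENNReal.ofReal_one]
        have h2 : ENNReal.ofReal (s / p * d ^ (s / p - 1)) ^ p * ENNReal.ofReal (d ^ (-s)) =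
            ENNReal.ofReal ((s / p) ^ p) * ENNReal.ofReal (d ^ (-p)) := by
          rw [ENNReal.ofReal_rpow_of_nonneg (by positivity) hp0.le,
            ← ENNReal.ofReal_mul (by positivity), ← ENNReal.ofReal_mul (by positivity),
            Real.mul_rpow hq.le (by positivity), ← Real.rpow_mul h0.le, mul_assoc,
            ← Real.rpow_add h0]
          congr 3
          field_simp
          ring
        rw [h1, h2]
        ring

end

theorem exists_mul_rpow_sub_one_le {p : ℝ} (hp : 1 < p) {K : ℝ} (hK : 0 ≤ K) :
    ∃ s : ℝ, 0 < s ∧ s ≤ 1 ∧ K * s ^ (p - 1) ≤ 1 / 2 := by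
  have hp1 : 0 < p - 1 := by linarith
  refine ⟨(1 / (2 * (K + 1))) ^ (1 / (p - 1)), by positivity,
    Real.rpow_le_one (by positivity) ?_ (by positivity), ?_⟩
  · rw [div_le_one (by positivity)]
    linarith
  · rw [← Real.rpow_mul (by positivity), one_div_mul_cancel hp1.ne', Real.rpow_one,
      mul_one_div, div_le_div_iff₀ (by positivity) two_pos]
    linarith

theorem lintegral_enorm_rpow_mul_infDist_rpow_ne_top {X : Type*} [PseudoMetricSpace X]
    [MeasurableSpace X] [OpensMeasurableSpace X] (μ : Measure X) [IsFiniteMeasureOnCompacts μ]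
    {φ : X → ℝ} (hφ : Continuous φ) (hc : HasCompactSupport φ) {F : Set X}
    (hpos : ∀ x ∈ tsupport φ, 0 < infDist x F) {p : ℝ} (hp : 0 < p) :
    ∫⁻ x, ‖φ x‖ₑ ^ p * ENNReal.ofReal (infDist x F ^ (-p)) ∂μ ≠ ∞ := by
  obtain ⟨d, hd, hdle⟩ := hc.isCompact.exists_forall_le' (continuous_infDist_pt F).continuousOn hpos
  obtain ⟨A, hA⟩ := hc.exists_bound_of_continuous hφ
  have hsub : (Function.support fun x => ‖φ x‖ₑ ^ p * ENNReal.ofReal (infDist x F ^ (-p))) ⊆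
      tsupport φ := by
    intro x hx
    by_contra h
    refine hx ?_
    simp [image_eq_zero_of_notMem_tsupport h, hp]
  rw [← setLIntegral_eq_of_support_subset hsub]
  have hle : ∫⁻ x in tsupport φ, ‖φ x‖ₑ ^ p * ENNReal.ofReal (infDist x F ^ (-p)) ∂μ ≤
      ∫⁻ _ in tsupport φ, ENNReal.ofReal A ^ p * ENNReal.ofReal (d ^ (-p)) ∂μ := by
    refine setLIntegral_mono_ae' (isClosed_tsupport φ).measurableSet (ae_of_all _ fun x hx => ?_)
    have hle : infDist x F ^ (-p) ≤ d ^ (-p) :=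
      Real.rpow_le_rpow_of_nonpos hd (hdle x hx) (by linarith)
    refine mul_le_mul' ?_ (ENNReal.ofReal_le_ofReal hle)
    rw [← ofReal_norm]
    gcongr
    exact hA x
  refine ne_top_of_le_ne_top ?_ hle
  rw [setLIntegral_const]
  have := hc.isCompact.measure_lt_top (μ := μ).ne
  finiteness

/-- The Hardy inequality with weight `dist(x, ∂Ω) ^ (-p)`, by testing the boundary Poincaré
inequality with `φ * dist(·, ∂Ω) ^ (s / p)` for small `s` and absorbing the error term. -/
theorem UniformlyFat.exists_lintegral_hardy_frontier {n : ℕ} (hn : 0 < n) {p : ℝ} (hp : 1 < p)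
    {c₀ r₀ : ℝ} (hc₀ : 0 < c₀) (hr₀ : 0 < r₀) {Ω : Set (EuclideanSpace ℝ (Fin n))}
    (hb : Bornology.IsBounded Ω) (hopen : IsOpen Ω) (hne : (frontier Ω).Nonempty)
    (hfat : UniformlyFat n p c₀ r₀ Ωᶜ) :
    ∃ C : ℝ≥0∞, C ≠ ∞ ∧
      ∀ (φ : EuclideanSpace ℝ (Fin n) → ℝ) (L : ℝ≥0), LipschitzWith L φ → Differentiable ℝ φ →
        HasCompactSupport φ → tsupport φ ⊆ Ω →
        ∫⁻ x, ‖φ x‖ₑ ^ p * ENNReal.ofReal (infDist x (frontier Ω) ^ (-p)) ≤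
          C * ∫⁻ x, ‖fderiv ℝ φ x‖ₑ ^ p := by
  have hp0 : 0 < p := by linarith
  obtain ⟨C, hC, A, hA, h⟩ := hfat.exists_sublevel_le hn hp.le hc₀ hr₀ hb hne
  obtain ⟨s, hs, hs1, hsK⟩ := exists_mul_rpow_sub_one_le hp
    (K := C.toReal * ((p + 1) * A) * 2 ^ p / p ^ p) (by positivity)
  set B : ℝ≥0∞ := C * ENNReal.ofReal ((p + 1) * A / s) * 2 ^ p with hB
  have hBtop : B ≠ ∞ := by finiteness
  have hBs : B * ENNReal.ofReal ((s / p) ^ p) ≤ 1 / 2 := by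
    have h2 : (2 : ℝ≥0∞) ^ p = ENNReal.ofReal (2 ^ p) := by
      rw [← ENNReal.ofReal_rpow_of_pos two_pos, ENNReal.ofReal_ofNat]
    rw [hB, ← ENNReal.ofReal_toReal hC, h2, ← ENNReal.ofReal_mul (by positivity),
      ← ENNReal.ofReal_mul (by positivity), ← ENNReal.ofReal_mul (by positivity),
      show (1 / 2 : ℝ≥0∞) = ENNReal.ofReal (1 / 2) by
        rw [ENNReal.ofReal_div_of_pos two_pos]; simp]
    refine ENNReal.ofReal_le_ofReal (le_trans (le_of_eq ?_) hsK)
    rw [Real.div_rpow hs.le hp0.le, Real.rpow_sub_one hs.ne']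
    ring
  refine ⟨2 * B, by finiteness, fun φ L hφ hdiff hc hφΩ => ?_⟩
  have hpos : ∀ x ∈ tsupport φ, 0 < infDist x (frontier Ω) := fun x hx =>
    (isClosed_frontier.notMem_iff_infDist_pos hne).1 fun hx' =>
      hopen.inter_frontier_eq.le ⟨hφΩ hx, hx'⟩
  obtain ⟨M, hM⟩ := hφ.exists_lipschitzWith_mul_infDist_rpow hc hpos (s / p)
  set u : EuclideanSpace ℝ (Fin n) → ℝ := fun x => φ x * infDist x (frontier Ω) ^ (s / p) with hu
  have hus : tsupport u ⊆ tsupport φ := tsupport_mul_subset_left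
  have huc : HasCompactSupport u := hc.mul_right
  have hδ : Measurable fun x : EuclideanSpace ℝ (Fin n) => infDist x (frontier Ω) :=
    measurable_infDist
  set X : ℝ≥0∞ := ∫⁻ x, ‖φ x‖ₑ ^ p * ENNReal.ofReal (infDist x (frontier Ω) ^ (-p)) with hX
  set Y : ℝ≥0∞ := ∫⁻ x, ‖fderiv ℝ φ x‖ₑ ^ p with hY
  have hXtop : X ≠ ∞ :=
    lintegral_enorm_rpow_mul_infDist_rpow_ne_top volume hφ.continuous hc hpos hp0
  have hG0 : ∀ x, infDist x (frontier Ω) = 0 → ‖fderiv ℝ u x‖ₑ ^ p = 0 := by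
    intro x hx
    have : fderiv ℝ u x = 0 := image_eq_zero_of_notMem_tsupport fun h' =>
      (hpos x (hus (tsupport_fderiv_subset ℝ h'))).ne' hx
    simp [← ofReal_norm, this, hp0]
  have h1 := lintegral_mul_rpow_le_of_sublevel_le volume
    (W := fun x => ‖u x‖ₑ ^ p) (G := fun x => ‖fderiv ℝ u x‖ₑ ^ p)
    (hM.continuous.measurable.enorm.pow_const p) ((measurable_fderiv ℝ u).enorm.pow_const p)
    hδ (fun _ => infDist_nonneg) hG0 hp0 hA (h u M hM huc (hus.trans hφΩ)) hs hs1
  have hlhs : X = ∫⁻ x, ‖u x‖ₑ ^ p * ENNReal.ofReal (infDist x (frontier Ω) ^ (-(p + s))) := by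
    refine lintegral_congr fun x => ?_
    by_cases hx : x ∈ tsupport φ
    · have h0 := hpos x hx
      rw [hu, enorm_mul, Real.enorm_of_nonneg (Real.rpow_nonneg h0.le _),
        ENNReal.mul_rpow_of_nonneg _ _ hp0.le,
        ENNReal.ofReal_rpow_of_nonneg (Real.rpow_nonneg h0.le _) hp0.le, ← Real.rpow_mul h0.le,
        div_mul_cancel₀ _ hp0.ne', mul_assoc, ← ENNReal.ofReal_mul (by positivity),
        ← Real.rpow_add h0, show s + -(p + s) = -p by ring]
    · simp [hu, image_eq_zero_of_notMem_tsupport hx, hp0]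
  have hrhs : ∫⁻ x, ‖fderiv ℝ u x‖ₑ ^ p * ENNReal.ofReal (infDist x (frontier Ω) ^ (-s)) ≤
      2 ^ p * (Y + ENNReal.ofReal ((s / p) ^ p) * X) := by
    have hXm : Measurable fun x => ‖φ x‖ₑ ^ p * ENNReal.ofReal (infDist x (frontier Ω) ^ (-p)) :=
      (hφ.continuous.measurable.enorm.pow_const p).mul (hδ.pow_const _).ennreal_ofReal
    have hYm : Measurable fun x => ‖fderiv ℝ φ x‖ₑ ^ p :=
      (measurable_fderiv ℝ φ).enorm.pow_const p
    rw [hX, hY, ← lintegral_const_mul _ hXm, ← lintegral_add_left hYm,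
      ← lintegral_const_mul' _ _ (by finiteness)]
    refine lintegral_mono_ae ?_
    filter_upwards [(lipschitz_infDist_pt (frontier Ω)).ae_differentiableAt (μ := volume)]
      with x hx
    rcases (infDist_nonneg (x := x) (s := frontier Ω)).eq_or_lt with h0 | h0
    · rw [hG0 x h0.symm, zero_mul]
      exact zero_le
    · exact enorm_fderiv_mul_infDist_rpow_rpow_mul_le hdiff hpos hp.le hs hx h0
  have hfinal : X ≤ B * Y + X / 2 := by
    calc X ≤ C * ENNReal.ofReal ((p + 1) * A / s) *
          (2 ^ p * (Y + ENNReal.ofReal ((s / p) ^ p) * X)) :=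
          (hlhs.le.trans h1).trans (by gcongr)
      _ = B * Y + (B * ENNReal.ofReal ((s / p) ^ p)) * X := by rw [hB]; ring
      _ ≤ B * Y + X / 2 := by
          gcongr
          rw [ENNReal.div_eq_inv_mul, ← one_div]
          gcongr
  have hhalf : X / 2 ≤ B * Y := by
    refine ENNReal.le_of_add_le_add_right (a := X / 2) (by finiteness) ?_
    rwa [ENNReal.add_halves]
  calc X = 2 * (X / 2) := (ENNReal.mul_div_cancel two_ne_zero (by finiteness)).symm
    _ ≤ 2 * (B * Y) := by gcongr
    _ = _ := (mul_assoc _ _ _).symm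

theorem Real.rpow_neg_add_mul_rpow_neg_le_add {a b p γ : ℝ} (ha : 0 < a) (hb : 0 < b) (hγ0 : 0 ≤ γ)
    (hγp : γ ≤ p) : a ^ (-p + γ) * b ^ (-γ) ≤ a ^ (-p) + b ^ (-p) := by
  rcases le_total a b with hab | hab
  · calc _ ≤ a ^ (-p + γ) * a ^ (-γ) :=
          mul_le_mul_of_nonneg_left (Real.rpow_le_rpow_of_nonpos ha hab (by linarith))
            (by positivity)
      _ = a ^ (-p) := by rw [← Real.rpow_add ha, add_neg_cancel_right]
      _ ≤ _ := le_add_of_nonneg_right (by positivity)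
  · calc _ ≤ b ^ (-p + γ) * b ^ (-γ) :=
          mul_le_mul_of_nonneg_right (Real.rpow_le_rpow_of_nonpos hb hab (by linarith))
            (by positivity)
      _ = b ^ (-p) := by rw [← Real.rpow_add hb, add_neg_cancel_right]
      _ ≤ _ := le_add_of_nonneg_left (by positivity)

theorem LipschitzWith.lintegral_hardy_point {E : Type*} [NormedAddCommGroup E] [NormedSpace ℝ E]
    [FiniteDimensional ℝ E] [MeasurableSpace E] [BorelSpace E] {u : E → ℝ} {K : ℝ≥0}
    (hu : LipschitzWith K u) (μ : Measure E) [μ.IsAddHaarMeasure] (hdiff : Differentiable ℝ u)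
    (hc : HasCompactSupport u) {p : ℝ} (hp : 1 ≤ p) (hpn : p < Module.finrank ℝ E) (x₀ : E) :
    ∫⁻ x, ‖u x‖ₑ ^ p * ‖x - x₀‖ₑ ^ (-p) ∂μ ≤
      ENNReal.ofReal (1 - 2 ^ (1 - Module.finrank ℝ E / p))⁻¹ ^ p *
        ∫⁻ x, ‖fderiv ℝ u x‖ₑ ^ p ∂μ := by
  have hv : LipschitzWith (K * 1) fun x => u (x + x₀) :=
    hu.comp (IsometryEquiv.addRight x₀).isometry.lipschitz
  have hvd : Differentiable ℝ fun x => u (x + x₀) := by fun_prop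
  have h := hv.lintegral_hardy_origin μ hvd (hc.comp_homeomorph (Homeomorph.addRight x₀)) hp hpn
  simp_rw [fderiv_comp_add_right] at h
  rw [lintegral_add_right_eq_self (fun x => ‖fderiv ℝ u x‖ₑ ^ p) x₀] at h
  rw [← lintegral_add_right_eq_self _ x₀]
  simpa using h

end Hardy

/-- **Corollary 4.7 (Euclidean case, `Q(x₀) = n`):** if `ℝⁿ∖Ω` is uniformly `p`-fat and
`0 ≤ γ ≤ p`, then for any `x₀ ∈ Ω` the mixed Hardy inequality
`∫_Ω |φ|^p δ(x)^{-p+γ} |x-x₀|^{-γ} ≤ C ∫_Ω |∇φ|^p` holds for all `φ ∈ C_c^∞(Ω)`. -/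
theorem mixed_hardy_inequality (n : ℕ) (hn : 3 ≤ n) (p γ : ℝ)
    (hp : 1 < p) (hpn : p < n) (hγ0 : 0 ≤ γ) (hγp : γ ≤ p)
    (Ω : Set (EuclideanSpace ℝ (Fin n)))
    (hb : Bornology.IsBounded Ω) (hconn : IsConnected Ω) (hopen : IsOpen Ω)
    (c₀ r₀ : ℝ) (hc₀ : 0 < c₀) (hr₀ : 0 < r₀) (hfat : UniformlyFat n p c₀ r₀ Ωᶜ)
    (x₀ : EuclideanSpace ℝ (Fin n)) (hx₀ : x₀ ∈ Ω) :
    ∃ C : ℝ, 0 < C ∧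
      ∀ φ : EuclideanSpace ℝ (Fin n) → ℝ, ContDiff ℝ (⊤ : ℕ∞) φ → HasCompactSupport φ →
        tsupport φ ⊆ Ω →
        (∫ x in Ω, |φ x| ^ p *
            (Metric.infDist x (frontier Ω) ^ (-p + γ) * ‖x - x₀‖ ^ (-γ))) ≤
          C * ∫ x in Ω, ‖fderiv ℝ φ x‖ ^ p := by
  have hp0 : 0 < p := by linarith
  have : Nontrivial (EuclideanSpace ℝ (Fin n)) :=
    Module.nontrivial_of_finrank_pos (R := ℝ) (by rw [finrank_euclideanSpace_fin]; omega)
  have hne : (frontier Ω).Nonempty := by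
    refine nonempty_frontier_iff.2 ⟨⟨x₀, hx₀⟩, ?_⟩
    rintro rfl
    exact NormedSpace.unbounded_univ ℝ _ hb
  obtain ⟨C, hC, h⟩ := hfat.exists_lintegral_hardy_frontier (by omega) hp hc₀ hr₀ hb hopen hne
  set D : ℝ≥0∞ := C + ENNReal.ofReal (1 - 2 ^ (1 - (n : ℝ) / p))⁻¹ ^ p with hD
  have hDtop : D ≠ ∞ := by finiteness
  refine ⟨D.toReal + 1, by positivity, fun φ hφ hc hφΩ => ?_⟩
  obtain ⟨K, hK⟩ := hφ.lipschitzWith_of_hasCompactSupport hc (by simp)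
  have hdiff : Differentiable ℝ φ := hφ.differentiable (by simp)
  have hint : 0 ≤ ∫ x in Ω, ‖fderiv ℝ φ x‖ ^ p := integral_nonneg fun x => by positivity
  have hδ : Measurable fun x : EuclideanSpace ℝ (Fin n) => infDist x (frontier Ω) :=
    measurable_infDist
  have hm : Measurable fun x => |φ x| ^ p *
      (infDist x (frontier Ω) ^ (-p + γ) * ‖x - x₀‖ ^ (-γ)) :=
    (hφ.continuous.measurable.norm.pow_const p).mul
      ((hδ.pow_const _).mul ((by fun_prop : Measurable fun x => ‖x - x₀‖).pow_const _))
  rw [integral_eq_lintegral_of_nonneg_ae (ae_of_all _ fun x => mul_nonneg (by positivity)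
    (mul_nonneg (Real.rpow_nonneg infDist_nonneg _) (by positivity))) hm.aestronglyMeasurable]
  refine ENNReal.toReal_le_of_le_ofReal (by positivity) ?_
  rw [ENNReal.ofReal_mul (by positivity), hK.ofReal_integral_norm_fderiv_rpow volume hc hp0,
    setLIntegral_enorm_fderiv_rpow_eq _ hp0 hφΩ]
  have hWm : Measurable fun x => ‖φ x‖ₑ ^ p * ENNReal.ofReal (infDist x (frontier Ω) ^ (-p)) :=
    (hφ.continuous.measurable.enorm.pow_const p).mul (hδ.pow_const _).ennreal_ofReal
  calc _ ≤ ∫⁻ x, ‖φ x‖ₑ ^ p * ENNReal.ofReal (infDist x (frontier Ω) ^ (-p)) +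
        ‖φ x‖ₑ ^ p * ‖x - x₀‖ₑ ^ (-p) := by
        refine (lintegral_mono_ae ?_).trans (setLIntegral_le_lintegral Ω _)
        filter_upwards [ae_restrict_mem hopen.measurableSet,
          ae_restrict_of_ae (Measure.ae_ne volume x₀)] with x hx hxx₀
        have h0 : 0 < infDist x (frontier Ω) :=
          (isClosed_frontier.notMem_iff_infDist_pos hne).1 fun hx' =>
            hopen.inter_frontier_eq.le ⟨hx, hx'⟩
        have h1 : 0 < ‖x - x₀‖ := norm_pos_iff.2 (sub_ne_zero.2 hxx₀)
        rw [← mul_add, ENNReal.ofReal_mul (by positivity), ← ofReal_norm (x - x₀), ← ofReal_norm,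
          Real.norm_eq_abs, ENNReal.ofReal_rpow_of_nonneg (abs_nonneg _) hp0.le,
          ENNReal.ofReal_rpow_of_pos h1, ← ENNReal.ofReal_add (by positivity) (by positivity)]
        gcongr
        exact Real.rpow_neg_add_mul_rpow_neg_le_add h0 h1 hγ0 hγp
    _ ≤ D * ∫⁻ x, ‖fderiv ℝ φ x‖ₑ ^ p := by
        rw [lintegral_add_left hWm, hD, add_mul]
        have h2 := hK.lintegral_hardy_point volume hdiff hc hp.le (by simpa using hpn) x₀
        rw [finrank_euclideanSpace_fin] at h2
        exact add_le_add (h φ K hK hdiff hc hφΩ) h2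
    _ ≤ _ := by
        gcongr
        rw [← ENNReal.ofReal_toReal hDtop]
        exact ENNReal.ofReal_le_ofReal (by simp)
end

section
/- Let n ≥ 3 and 1 < p < n. There exists a constant c = c(n,p) > 0 with the following property: for every bounded open set Ω ⊆ ℝⁿ, every x₀ ∈ Ω and r > 0 with B(x₀,4r) ⊆ Ω, and every compact set K ⊆ B(x₀,2r), one has c · cap_p(K, Ω) ≤ cap_p(K, ℝⁿ) ≤ cap_p(K, Ω). -/
open MeasureTheory Metric
open scoped NNReal ENNReal

section CapacityComparison

open Set Filter Topology

section LipschitzCompactSupport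

variable {E : Type*} [NormedAddCommGroup E]

/-- A compactly supported locally Lipschitz function is globally Lipschitz. -/
theorem LocallyLipschitz.exists_lipschitzWith_of_hasCompactSupport [ProperSpace E] {f : E → ℝ}
    (hf : LocallyLipschitz f) (hc : HasCompactSupport f) : ∃ L : ℝ≥0, LipschitzWith L f := by
  obtain ⟨R, hR⟩ := hc.isCompact.isBounded.subset_closedBall (0 : E)
  obtain ⟨M, hM⟩ := hc.exists_bound_of_continuous hf.continuous
  obtain ⟨L, hL⟩ := LocallyLipschitzOn.exists_lipschitzOnWith_of_compact
    (isCompact_closedBall (0 : E) (R + 1)) hf.locallyLipschitzOn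
  have hM0 : 0 ≤ M := (norm_nonneg _).trans (hM 0)
  have hzero : ∀ x, x ∉ closedBall (0 : E) R → f x = 0 := fun x hx =>
    image_eq_zero_of_notMem_tsupport fun h => hx (hR h)
  have key : ∀ x y, x ∈ closedBall (0 : E) R → dist (f x) (f y) ≤ (L + M) * dist x y := by
    intro x y hx
    have hd : (0 : ℝ) ≤ dist x y := dist_nonneg
    have hL0 : (0 : ℝ) ≤ L := L.2
    by_cases hy : y ∈ closedBall (0 : E) (R + 1)
    · have := hL.dist_le_mul x (closedBall_subset_closedBall (by linarith) hx) y hy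
      nlinarith
    · have hfy : f y = 0 :=
        hzero y fun h => hy (closedBall_subset_closedBall (by linarith) h)
      have h1 : 1 ≤ dist x y := by
        rw [mem_closedBall, not_le] at hy
        rw [mem_closedBall] at hx
        have := dist_triangle y x 0
        rw [dist_comm y x] at this
        linarith
      have h2 := hM x
      rw [hfy, dist_zero_right]
      nlinarith [mul_nonneg hL0 hd]
  refine ⟨Real.toNNReal (L + M), LipschitzWith.of_dist_le' fun x y => ?_⟩
  by_cases hx : x ∈ closedBall (0 : E) R
  · exact key x y hx
  by_cases hy : y ∈ closedBall (0 : E) R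
  · rw [dist_comm, dist_comm x y]
    exact key y x hy
  · rw [hzero x hx, hzero y hy, dist_self]
    have : (0 : ℝ) ≤ L := L.2
    positivity

theorem LocallyLipschitz.mul_real {f g : E → ℝ} (hf : LocallyLipschitz f)
    (hg : LocallyLipschitz g) : LocallyLipschitz fun x => f x * g x :=
  (contDiff_mul (𝕜 := ℝ) (n := 1) (𝔸 := ℝ)).locallyLipschitz.comp (hf.prodMk hg)

theorem MeasureTheory.integrable_of_bounded_of_hasCompactSupport [MeasurableSpace E]
    {μ : Measure E} [IsFiniteMeasureOnCompacts μ] {F : E → ℝ} {s : Set E}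
    (hF : AEStronglyMeasurable F μ) (hs : IsCompact s) {M : ℝ} (hM : ∀ x ∈ s, ‖F x‖ ≤ M)
    (hms : MeasurableSet s) (h0 : ∀ x, x ∉ s → F x = 0) : Integrable F μ := by
  rw [← integrableOn_iff_integrable_of_support_subset (s := s)
    (fun x hx => by by_contra h; exact hx (h0 x h))]
  exact Measure.integrableOn_of_bounded hs.measure_lt_top.ne hF
    ((ae_restrict_iff' hms).2 (Eventually.of_forall hM))

variable [NormedSpace ℝ E] [MeasurableSpace E] [BorelSpace E]
  {μ : Measure E} [IsFiniteMeasureOnCompacts μ]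

theorem LipschitzWith.integrable_norm_fderiv_rpow {f : E → ℝ} {L : ℝ≥0} (hf : LipschitzWith L f)
    (hc : HasCompactSupport f) {p : ℝ} (hp : 0 < p) :
    Integrable (fun x => ‖fderiv ℝ f x‖ ^ p) μ := by
  refine integrable_of_bounded_of_hasCompactSupport (s := tsupport f) (M := (L : ℝ) ^ p)
    ((measurable_fderiv ℝ f).norm.pow_const p).aestronglyMeasurable hc.isCompact (fun x _ => ?_)
    (isClosed_tsupport f).measurableSet (fun x hx => ?_)
  · rw [Real.norm_of_nonneg (by positivity)]
    exact Real.rpow_le_rpow (norm_nonneg _) (norm_fderiv_le_of_lipschitz ℝ hf) hp.le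
  · rw [fderiv_of_notMem_tsupport ℝ hx, norm_zero, Real.zero_rpow hp.ne']

theorem LipschitzWith.integrable_fderiv_apply_mul {f : E → ℝ} {L : ℝ≥0} (hf : LipschitzWith L f)
    (hc : HasCompactSupport f) {g : E → ℝ} (hg : Continuous g) (v : E) :
    Integrable (fun x => fderiv ℝ f x v * g x) μ := by
  obtain ⟨M, hM⟩ := hc.isCompact.exists_bound_of_continuousOn hg.continuousOn
  refine integrable_of_bounded_of_hasCompactSupport (s := tsupport f) (M := L * ‖v‖ * M)
    ((measurable_fderiv_apply_const ℝ f v).mul hg.measurable).aestronglyMeasurable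
    hc.isCompact (fun x hx => ?_)
    (isClosed_tsupport f).measurableSet (fun x hx => ?_)
  · rw [norm_mul]
    have h1 : ‖fderiv ℝ f x v‖ ≤ L * ‖v‖ :=
      ((fderiv ℝ f x).le_opNorm v).trans
        (by gcongr; exact norm_fderiv_le_of_lipschitz ℝ hf)
    have := hM x hx
    gcongr
  · simp [fderiv_of_notMem_tsupport ℝ hx]

end LipschitzCompactSupport

section EulerIdentity

variable {ι : Type*} [Fintype ι]

theorem fderiv_apply_eq_sum (f : EuclideanSpace ℝ ι → ℝ)
    (x y : EuclideanSpace ℝ ι) [DecidableEq ι] :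
    fderiv ℝ f x y = ∑ i, fderiv ℝ f x (EuclideanSpace.single i 1) * y i := by
  conv_lhs => rw [← (EuclideanSpace.basisFun ι ℝ).sum_repr y]
  simp [mul_comm]

theorem LipschitzWith.integrable_fderiv_apply_sub {f : EuclideanSpace ℝ ι → ℝ} {L : ℝ≥0}
    (hf : LipschitzWith L f) (hc : HasCompactSupport f) (a : EuclideanSpace ℝ ι) :
    Integrable fun x => fderiv ℝ f x (x - a) := by
  classical
  simp_rw [fun x => fderiv_apply_eq_sum f x (x - a)]
  exact integrable_finsetSum _ fun i _ => hf.integrable_fderiv_apply_mul hc (by fun_prop) _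

/-- The integrated form of Euler's identity: the divergence of `x ↦ x - a` is the dimension. -/
theorem LipschitzWith.integral_fderiv_apply_sub {f : EuclideanSpace ℝ ι → ℝ} {L : ℝ≥0}
    (hf : LipschitzWith L f) (hc : HasCompactSupport f) (a : EuclideanSpace ℝ ι) :
    ∫ x, fderiv ℝ f x (x - a) = -(Fintype.card ι * ∫ x, f x) := by
  classical
  have hcoord : ∀ i, ∫ x, fderiv ℝ f x (EuclideanSpace.single i 1) * (x - a) i = -∫ x, f x := by
    intro i
    have hlip : LipschitzWith 1 fun x : EuclideanSpace ℝ ι => (x - a) i :=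
      LipschitzWith.mk_one fun x y => by
        simpa [dist_eq_norm] using PiLp.norm_apply_le (x - y) i
    have hline : ∀ x : EuclideanSpace ℝ ι,
        lineDeriv ℝ (fun x : EuclideanSpace ℝ ι => (x - a) i) x (EuclideanSpace.single i 1) = 1 := by
      intro x
      have h : HasFDerivAt (fun x : EuclideanSpace ℝ ι => (x - a) i)
          (EuclideanSpace.proj i : EuclideanSpace ℝ ι →L[ℝ] ℝ) x := by
        simpa using! (EuclideanSpace.proj i : EuclideanSpace ℝ ι →L[ℝ] ℝ).hasFDerivAt.sub_const (a i)
      rw [(h.hasLineDerivAt _).lineDeriv]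
      simp
    have h := integral_lineDeriv_mul_eq (μ := volume) hlip hf hc (EuclideanSpace.single i 1)
    simp_rw [hline, one_mul] at h
    rw [h, ← integral_neg]
    refine integral_congr_ae ?_
    filter_upwards [hf.ae_differentiableAt (μ := volume)] with x hx
    rw [lineDeriv_neg, hx.lineDeriv_eq_fderiv]
    ring
  simp_rw [fun x => fderiv_apply_eq_sum f x (x - a)]
  rw [integral_finsetSum _ fun i _ => hf.integrable_fderiv_apply_mul hc (by fun_prop) _]
  rw [Finset.sum_congr rfl fun i _ => hcoord i]
  simp

end EulerIdentity

section Hardy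

theorem Real.mul_rpow_sub_one_mul_le {p ε a b : ℝ} (hp : 1 < p) (hε : 0 < ε) (ha : 0 ≤ a)
    (hb : 0 ≤ b) :
    a ^ (p - 1) * b ≤ ε * a ^ p + ε⁻¹ ^ (p - 1) * b ^ p := by
  have hsplit : ∀ t : ℝ, 0 ≤ t → t ^ p = t ^ (p - 1) * t := fun t ht => by
    rw [← Real.rpow_add_one' ht (by linarith), sub_add_cancel]
  rcases le_total b (ε * a) with h | h
  · have : a ^ (p - 1) * b ≤ ε * a ^ p := by
      rw [hsplit a ha]
      calc a ^ (p - 1) * b ≤ a ^ (p - 1) * (ε * a) := by gcongr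
        _ = _ := by ring
    have h2 : 0 ≤ ε⁻¹ ^ (p - 1) * b ^ p := by positivity
    linarith
  · have : a ≤ ε⁻¹ * b := by rwa [← div_eq_inv_mul, le_div_iff₀ hε, mul_comm]
    have h1 : a ^ (p - 1) * b ≤ ε⁻¹ ^ (p - 1) * b ^ p := by
      rw [hsplit b hb, ← mul_assoc, ← Real.mul_rpow (by positivity) hb]
      gcongr
    have h2 : 0 ≤ ε * a ^ p := by positivity
    linarith

theorem Real.add_rpow_le_two_rpow_mul {p a b : ℝ} (hp : 0 ≤ p) (ha : 0 ≤ a) (hb : 0 ≤ b) :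
    (a + b) ^ p ≤ 2 ^ p * (a ^ p + b ^ p) := by
  have hap : 0 ≤ a ^ p := by positivity
  have hbp : 0 ≤ b ^ p := by positivity
  rcases le_total a b with h | h
  · calc (a + b) ^ p ≤ (2 * b) ^ p := by gcongr; linarith
      _ = 2 ^ p * b ^ p := Real.mul_rpow (by norm_num) hb
      _ ≤ _ := by gcongr; linarith
  · calc (a + b) ^ p ≤ (2 * a) ^ p := by gcongr; linarith
      _ = 2 ^ p * a ^ p := Real.mul_rpow (by norm_num) ha
      _ ≤ _ := by gcongr; linarith

variable {E : Type*} [NormedAddCommGroup E] [InnerProductSpace ℝ E]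

theorem contDiff_inv_sqrt_norm_sq_add (a : E) {r : ℝ} (hr : 0 < r) :
    ContDiff ℝ 1 fun x : E => (√(‖x - a‖ ^ 2 + r ^ 2))⁻¹ := by
  have hpos : ∀ x : E, 0 < ‖x - a‖ ^ 2 + r ^ 2 := fun x => by positivity
  refine ContDiff.inv (ContDiff.sqrt ?_ fun x => (hpos x).ne')
    fun x => (Real.sqrt_pos.2 (hpos x)).ne'
  exact ((contDiff_id.sub contDiff_const).norm_sq ℝ).add contDiff_const

theorem fderiv_mul_inv_sqrt_apply_sub {φ : E → ℝ} {x a : E} {r : ℝ} (hr : 0 < r)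
    (hφ : DifferentiableAt ℝ φ x) :
    fderiv ℝ (fun y => φ y * (√(‖y - a‖ ^ 2 + r ^ 2))⁻¹) x (x - a) =
      (fderiv ℝ φ x (x - a)) / √(‖x - a‖ ^ 2 + r ^ 2) -
        φ x * (√(‖x - a‖ ^ 2 + r ^ 2))⁻¹ * (‖x - a‖ ^ 2 / (‖x - a‖ ^ 2 + r ^ 2)) := by
  have hpos : 0 < ‖x - a‖ ^ 2 + r ^ 2 := by positivity
  have hs := Real.sqrt_pos.2 hpos
  have h1 : HasFDerivAt (fun y : E => ‖y - a‖ ^ 2 + r ^ 2)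
      (2 • (innerSL ℝ (x - a)).comp (ContinuousLinearMap.id ℝ E)) x :=
    (((hasFDerivAt_id x).sub_const a).norm_sq).add_const _
  have h2 := (h1.sqrt hpos.ne')
  have h3 := (hasDerivAt_inv hs.ne').comp_hasFDerivAt x h2
  have h4 := hφ.hasFDerivAt.mul h3
  have h5 : fderiv ℝ (fun y => φ y * (√(‖y - a‖ ^ 2 + r ^ 2))⁻¹) x = _ := h4.fderiv
  rw [h5]
  simp only [Function.comp_apply, ContinuousLinearMap.comp_id, add_apply,
    smul_apply, innerSL_apply_apply, real_inner_self_eq_norm_sq, smul_eq_mul,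
    nsmul_eq_mul, Nat.cast_ofNat]
  rw [Real.sq_sqrt hpos.le]
  field_simp
  ring

variable {ι : Type*} [Fintype ι]

/-- A Hardy inequality with the regularized weight `(‖x - a‖² + r²)^(-p/2)`. -/
theorem LipschitzWith.integral_hardy_le {p : ℝ} (hp : 1 < p) (hpn : p < Fintype.card ι)
    {φ : EuclideanSpace ℝ ι → ℝ} {L : ℝ≥0} (hφ : LipschitzWith L φ) (hc : HasCompactSupport φ)
    (a : EuclideanSpace ℝ ι) {r : ℝ} (hr : 0 < r) :
    Integrable (fun x => |φ x * (√(‖x - a‖ ^ 2 + r ^ 2))⁻¹| ^ p) ∧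
    ∫ x, |φ x * (√(‖x - a‖ ^ 2 + r ^ 2))⁻¹| ^ p ≤
      (2 * p / (Fintype.card ι - p)) ^ p * ∫ x, ‖fderiv ℝ φ x‖ ^ p := by
  set u : EuclideanSpace ℝ ι → ℝ := fun x => φ x * (√(‖x - a‖ ^ 2 + r ^ 2))⁻¹ with hu
  set N : ℝ := (Fintype.card ι : ℝ) with hN
  have hNp : 0 < N - p := sub_pos.2 hpn
  have hp0 : 0 < p := by linarith
  have hlu : LocallyLipschitz u :=
    hφ.locallyLipschitz.mul_real (contDiff_inv_sqrt_norm_sq_add a hr).locallyLipschitz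
  have hcu : HasCompactSupport u := hc.mul_right
  have hlg : LocallyLipschitz fun x => |u x| ^ p :=
    (contDiff_norm_rpow (E := ℝ) hp).locallyLipschitz.comp hlu
  have hcg : HasCompactSupport fun x => |u x| ^ p :=
    hcu.comp_left (g := fun t : ℝ => |t| ^ p) (by simp [hp0.ne'])
  obtain ⟨Lg, hLg⟩ := hlg.exists_lipschitzWith_of_hasCompactSupport hcg
  have hgint : Integrable fun x => |u x| ^ p := hlg.continuous.integrable_of_hasCompactSupport hcg
  refine ⟨hgint, ?_⟩
  set ε : ℝ := (N - p) / (2 * p) with hεdef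
  have hε : 0 < ε := by positivity
  have hDint := hφ.integrable_norm_fderiv_rpow (μ := volume) hc hp0
  have hpt : ∀ᵐ x : EuclideanSpace ℝ ι,
      -(p * (1 + ε)) * |u x| ^ p - p * ε⁻¹ ^ (p - 1) * ‖fderiv ℝ φ x‖ ^ p ≤
        fderiv ℝ (fun x => |u x| ^ p) x (x - a) := by
    filter_upwards [hφ.ae_differentiableAt (μ := volume)] with x hx
    have hpos : 0 < ‖x - a‖ ^ 2 + r ^ 2 := by positivity
    set s := √(‖x - a‖ ^ 2 + r ^ 2) with hs
    have hs0 : 0 < s := Real.sqrt_pos.2 hpos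
    have hxs : ‖x - a‖ ≤ s := Real.le_sqrt_of_sq_le (by nlinarith [sq_nonneg r])
    have hudiff : DifferentiableAt ℝ u x :=
      hx.mul ((contDiff_inv_sqrt_norm_sq_add a hr).differentiable one_ne_zero x)
    have hchain : fderiv ℝ (fun x => |u x| ^ p) x =
        (p * |u x| ^ (p - 2) * u x) • fderiv ℝ u x :=
      ((hasDerivAt_abs_rpow (u x) hp).comp_hasFDerivAt x hudiff.hasFDerivAt).fderiv
    rw [hchain, smul_apply, smul_eq_mul,
      fderiv_mul_inv_sqrt_apply_sub hr hx, ← hs]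
    set q := ‖x - a‖ ^ 2 / (‖x - a‖ ^ 2 + r ^ 2)
    have hq1 : q ≤ 1 := (div_le_one hpos).2 (by nlinarith [sq_nonneg r])
    have hD : |fderiv ℝ φ x (x - a) / s| ≤ ‖fderiv ℝ φ x‖ := by
      rw [abs_div, abs_of_pos hs0, div_le_iff₀ hs0]
      exact ((fderiv ℝ φ x).le_opNorm (x - a)).trans (by gcongr)
    have hpow2 : |u x| ^ (p - 2) * u x * u x = |u x| ^ p := by
      rcases eq_or_ne (u x) 0 with h | h
      · simp [h, hp0.ne']
      · rw [mul_assoc, ← abs_mul_abs_self (u x), ← sq, ← Real.rpow_natCast,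
          ← Real.rpow_add (abs_pos.2 h)]
        norm_num
    have hpow1 : |(|u x| ^ (p - 2) * u x)| = |u x| ^ (p - 1) := by
      rcases eq_or_ne (u x) 0 with h | h
      · simp [h, (sub_pos.2 hp).ne']
      · rw [abs_mul, abs_of_nonneg (by positivity), ← Real.rpow_add_one (abs_ne_zero.2 h)]
        congr 1
        ring
    have hux : φ x * s⁻¹ = u x := rfl
    rw [hux]
    have hyoung := Real.mul_rpow_sub_one_mul_le hp hε (abs_nonneg (u x))
      (norm_nonneg (fderiv ℝ φ x))
    have hcross : -(|u x| ^ (p - 1) * ‖fderiv ℝ φ x‖) ≤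
        |u x| ^ (p - 2) * u x * (fderiv ℝ φ x (x - a) / s) := by
      refine neg_le_of_abs_le ?_
      rw [abs_mul, hpow1]
      gcongr
    have hup : 0 ≤ |u x| ^ p := by positivity
    have hsecond : |u x| ^ (p - 2) * u x * (u x * q) ≤ |u x| ^ p := by
      rw [← mul_assoc, hpow2]
      exact mul_le_of_le_one_right hup hq1
    calc -(p * (1 + ε)) * |u x| ^ p - p * ε⁻¹ ^ (p - 1) * ‖fderiv ℝ φ x‖ ^ p
        = p * (-(ε * |u x| ^ p + ε⁻¹ ^ (p - 1) * ‖fderiv ℝ φ x‖ ^ p) - |u x| ^ p) := by ring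
      _ ≤ p * (|u x| ^ (p - 2) * u x * (fderiv ℝ φ x (x - a) / s) -
            |u x| ^ (p - 2) * u x * (u x * q)) := by gcongr; linarith
      _ = _ := by ring
  have hmono := integral_mono_ae
    ((hgint.const_mul (-(p * (1 + ε)))).sub (hDint.const_mul (p * ε⁻¹ ^ (p - 1))))
    (hLg.integrable_fderiv_apply_sub hcg a) hpt
  rw [hLg.integral_fderiv_apply_sub hcg a, integral_sub' (hgint.const_mul _) (hDint.const_mul _),
    integral_const_mul, integral_const_mul, ← hN] at hmono
  have hconst : N - p * (1 + ε) = p * ε := by rw [hεdef]; field_simp; ring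
  have hfin : p * ε * ∫ x, |u x| ^ p ≤ p * ε⁻¹ ^ (p - 1) * ∫ x, ‖fderiv ℝ φ x‖ ^ p := by
    rw [← hconst]
    linarith
  have hεinv : 2 * p / (N - p) = ε⁻¹ := by rw [hεdef, inv_div]
  have hεp : ε⁻¹ ^ p = ε⁻¹ ^ (p - 1) * ε⁻¹ := by
    rw [← Real.rpow_add_one (by positivity), sub_add_cancel]
  rw [hεinv, hεp]
  calc ∫ x, |u x| ^ p = (p * ε)⁻¹ * (p * ε * ∫ x, |u x| ^ p) := by field_simp
    _ ≤ (p * ε)⁻¹ * (p * ε⁻¹ ^ (p - 1) * ∫ x, ‖fderiv ℝ φ x‖ ^ p) := by gcongr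
    _ = _ := by field_simp

end Hardy

section Cutoff

theorem exists_lipschitz_cutoff_s16 {X : Type*} [PseudoMetricSpace X] (a : X) {r : ℝ} (hr : 0 < r) :
    ∃ η : X → ℝ, LipschitzWith (Real.toNNReal r⁻¹) η ∧ (∀ x, η x ∈ Icc (0 : ℝ) 1) ∧
      (∀ x ∈ closedBall a (2 * r), η x = 1) ∧ ∀ x ∉ closedBall a (3 * r), η x = 0 := by
  refine ⟨fun x => max 0 (min 1 (3 - r⁻¹ * dist x a)), ?_, fun x => ⟨le_max_left _ _, ?_⟩,
    fun x hx => ?_, fun x hx => ?_⟩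
  · refine LipschitzWith.const_max (LipschitzWith.const_min (LipschitzWith.of_le_add_mul' _ ?_) 1) 0
    intro x y
    have h := mul_le_mul_of_nonneg_left (dist_triangle_left y a x) (inv_pos.2 hr).le
    linarith
  · exact max_le zero_le_one (min_le_left _ _)
  · have h : r⁻¹ * dist x a ≤ 2 := by
      rw [inv_mul_le_iff₀ hr, mul_comm]
      exact hx
    beta_reduce
    rw [min_eq_left (by linarith), max_eq_right zero_le_one]
  · have h : 3 ≤ r⁻¹ * dist x a := by
      rw [le_inv_mul_iff₀ hr, mul_comm]
      exact (not_le.1 hx).le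
    beta_reduce
    exact max_eq_left ((min_le_right _ _).trans (by linarith))

variable {ι : Type*} [Fintype ι]

/-- Multiplication by a cutoff function multiplies the `p`-energy at most by a constant depending
only on `p` and on the dimension. -/
theorem LipschitzWith.exists_localization {p : ℝ} (hp : 1 < p) (hpn : p < Fintype.card ι)
    {φ : EuclideanSpace ℝ ι → ℝ} {L : ℝ≥0} (hφ : LipschitzWith L φ) (hc : HasCompactSupport φ)
    (a : EuclideanSpace ℝ ι) {r : ℝ} (hr : 0 < r) :
    ∃ ψ : EuclideanSpace ℝ ι → ℝ, (∃ L' : ℝ≥0, LipschitzWith L' ψ) ∧ HasCompactSupport ψ ∧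
      tsupport ψ ⊆ closedBall a (3 * r) ∧ (∀ x ∈ closedBall a (2 * r), ψ x = φ x) ∧
      ∫ x, ‖fderiv ℝ ψ x‖ ^ p ≤
        2 ^ p * (1 + 4 ^ p * (2 * p / (Fintype.card ι - p)) ^ p) * ∫ x, ‖fderiv ℝ φ x‖ ^ p := by
  obtain ⟨η, hη, hη01, hη1, hη0⟩ := exists_lipschitz_cutoff_s16 a hr
  obtain ⟨hu, hardy⟩ := hφ.integral_hardy_le hp hpn hc a hr
  have hp0 : 0 < p := by linarith
  set ψ : EuclideanSpace ℝ ι → ℝ := fun x => φ x * η x with hψ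
  have hcψ : HasCompactSupport ψ := hc.mul_right
  obtain ⟨L', hL'⟩ := (hφ.locallyLipschitz.mul_real
    hη.locallyLipschitz).exists_lipschitzWith_of_hasCompactSupport hcψ
  have hts : tsupport ψ ⊆ closedBall a (3 * r) := by
    refine closure_minimal (fun x hx => ?_) isClosed_closedBall
    by_contra h
    exact hx (by simp [hψ, hη0 x h])
  refine ⟨ψ, ⟨L', hL'⟩, hcψ, hts, fun x hx => by simp [hψ, hη1 x hx], ?_⟩
  have hDφ := hφ.integrable_norm_fderiv_rpow (μ := volume) hc hp0
  have hpt : ∀ᵐ x : EuclideanSpace ℝ ι, ‖fderiv ℝ ψ x‖ ^ p ≤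
      2 ^ p * (‖fderiv ℝ φ x‖ ^ p + 4 ^ p * |φ x * (√(‖x - a‖ ^ 2 + r ^ 2))⁻¹| ^ p) := by
    filter_upwards [hφ.ae_differentiableAt (μ := volume), hη.ae_differentiableAt (μ := volume)]
      with x hxφ hxη
    by_cases hx : x ∈ closedBall a (3 * r)
    · have hpos : 0 < ‖x - a‖ ^ 2 + r ^ 2 := by positivity
      set s := √(‖x - a‖ ^ 2 + r ^ 2)
      have hs0 : 0 < s := Real.sqrt_pos.2 hpos
      have hs4 : s ≤ 4 * r := by
        rw [mem_closedBall, dist_eq_norm] at hx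
        exact Real.sqrt_le_iff.2 ⟨by positivity, by nlinarith [norm_nonneg (x - a)]⟩
      have hφu : |φ x| * r⁻¹ ≤ 4 * |φ x * s⁻¹| := by
        rw [abs_mul, abs_of_pos (inv_pos.2 hs0)]
        have : r⁻¹ ≤ 4 * s⁻¹ := by
          rw [← div_eq_mul_inv, le_div_iff₀ hs0, inv_mul_le_iff₀ hr]
          linarith
        nlinarith [abs_nonneg (φ x)]
      have hDη : ‖fderiv ℝ η x‖ ≤ r⁻¹ := by
        simpa [hr.le] using norm_fderiv_le_of_lipschitz ℝ hη (x₀ := x)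
      have hDψ : ‖fderiv ℝ ψ x‖ ≤ ‖fderiv ℝ φ x‖ + 4 * |φ x * s⁻¹| := by
        rw [hψ, fderiv_fun_mul hxφ hxη]
        refine (norm_add_le _ _).trans ?_
        rw [norm_smul, norm_smul, Real.norm_eq_abs, Real.norm_eq_abs, abs_of_nonneg (hη01 x).1]
        have h1 := mul_le_mul_of_nonneg_left hDη (abs_nonneg (φ x))
        have h2 := mul_le_of_le_one_left (norm_nonneg (fderiv ℝ φ x)) (hη01 x).2
        linarith
      calc ‖fderiv ℝ ψ x‖ ^ p ≤ (‖fderiv ℝ φ x‖ + 4 * |φ x * s⁻¹|) ^ p := by gcongr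
        _ ≤ 2 ^ p * (‖fderiv ℝ φ x‖ ^ p + (4 * |φ x * s⁻¹|) ^ p) :=
          Real.add_rpow_le_two_rpow_mul hp0.le (norm_nonneg _) (by positivity)
        _ = _ := by rw [Real.mul_rpow (by norm_num) (abs_nonneg _)]
    · rw [fderiv_of_notMem_tsupport ℝ fun h => hx (hts h), norm_zero, Real.zero_rpow hp0.ne']
      positivity
  calc ∫ x, ‖fderiv ℝ ψ x‖ ^ p
      ≤ ∫ x, 2 ^ p * (‖fderiv ℝ φ x‖ ^ p + 4 ^ p * |φ x * (√(‖x - a‖ ^ 2 + r ^ 2))⁻¹| ^ p) :=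
        integral_mono_ae (hL'.integrable_norm_fderiv_rpow hcψ hp0)
          ((hDφ.add (hu.const_mul _)).const_mul _) hpt
    _ = 2 ^ p * ((∫ x, ‖fderiv ℝ φ x‖ ^ p) +
          4 ^ p * ∫ x, |φ x * (√(‖x - a‖ ^ 2 + r ^ 2))⁻¹| ^ p) := by
        rw [integral_const_mul, integral_add hDφ (hu.const_mul _), integral_const_mul]
    _ ≤ 2 ^ p * ((∫ x, ‖fderiv ℝ φ x‖ ^ p) + 4 ^ p * ((2 * p / (Fintype.card ι - p)) ^ p *
          ∫ x, ‖fderiv ℝ φ x‖ ^ p)) := by gcongr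
    _ = _ := by ring

end Cutoff

theorem setIntegral_norm_fderiv_rpow_eq_integral {E : Type*} [NormedAddCommGroup E]
    [NormedSpace ℝ E] [MeasurableSpace E] {μ : Measure E} {φ : E → ℝ} {U : Set E} {p : ℝ}
    (hp : p ≠ 0) (hU : tsupport φ ⊆ U) :
    ∫ x in U, ‖fderiv ℝ φ x‖ ^ p ∂μ = ∫ x, ‖fderiv ℝ φ x‖ ^ p ∂μ :=
  setIntegral_eq_integral_of_forall_compl_eq_zero fun x hx => by
    rw [fderiv_of_notMem_tsupport ℝ fun h => hx (hU h), norm_zero, Real.zero_rpow hp]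

end CapacityComparison

/-- **Capacity comparability** (Remark 4.4, Euclidean case): there is `c = c(n,p) > 0` such
that for every bounded open `Ω`, every ball `B(x₀,4r) ⊆ Ω` and every compact
`K ⊆ B(x₀,2r)`, one has `c · cap_p(K,Ω) ≤ cap_p(K,ℝⁿ) ≤ cap_p(K,Ω)`. -/
theorem capacity_comparison (n : ℕ) (hn : 3 ≤ n) (p : ℝ) (hp : 1 < p) (hpn : p < n) :
    ∃ c : ℝ, 0 < c ∧
      ∀ (Ω : Set (EuclideanSpace ℝ (Fin n))), Bornology.IsBounded Ω → IsOpen Ω →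
        ∀ (x₀ : EuclideanSpace ℝ (Fin n)) (r : ℝ), 0 < r → x₀ ∈ Ω →
          ball x₀ (4 * r) ⊆ Ω →
          ∀ K : Set (EuclideanSpace ℝ (Fin n)), IsCompact K → K ⊆ ball x₀ (2 * r) →
            c * pCap n p K Ω ≤ pCap n p K Set.univ ∧
              pCap n p K Set.univ ≤ pCap n p K Ω := by
  have hp0 : 0 < p := by linarith
  have hpn' : p < Fintype.card (Fin n) := by simpa using hpn
  have hnp : 0 < (Fintype.card (Fin n) : ℝ) - p := sub_pos.2 hpn'
  set C : ℝ := 2 ^ p * (1 + 4 ^ p * (2 * p / (Fintype.card (Fin n) - p)) ^ p)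
  have hC : 0 < C := by positivity
  refine ⟨C⁻¹, inv_pos.2 hC, fun Ω _ _ x₀ r hr _ hball K _ hK => ?_⟩
  have h3 : closedBall x₀ (3 * r) ⊆ Ω :=
    (closedBall_subset_ball (by linarith)).trans hball
  have hK2 : K ⊆ closedBall x₀ (2 * r) := hK.trans ball_subset_closedBall
  have hbdd : ∀ U : Set (EuclideanSpace ℝ (Fin n)), BddBelow { c : ℝ |
      ∃ φ : EuclideanSpace ℝ (Fin n) → ℝ, (∃ L : ℝ≥0, LipschitzWith L φ) ∧
        HasCompactSupport φ ∧ tsupport φ ⊆ U ∧ (∀ x ∈ K, 1 ≤ φ x) ∧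
        c = ∫ x in U, ‖fderiv ℝ φ x‖ ^ p } := by
    refine fun U => ⟨0, ?_⟩
    rintro _ ⟨φ, -, -, -, -, rfl⟩
    exact integral_nonneg fun x => by positivity
  obtain ⟨η, hη, -, hη1, hη0⟩ := exists_lipschitz_cutoff_s16 x₀ hr
  have hηts : tsupport η ⊆ closedBall x₀ (3 * r) := by
    refine closure_minimal (fun x hx => ?_) isClosed_closedBall
    by_contra h
    exact hx (hη0 x h)
  have hηc : HasCompactSupport η :=
    HasCompactSupport.intro (isCompact_closedBall x₀ (3 * r)) hη0
  have hηK : ∀ x ∈ K, 1 ≤ η x := fun x hx => (hη1 x (hK2 hx)).ge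
  constructor
  · refine le_csInf ⟨_, η, ⟨_, hη⟩, hηc, Set.subset_univ _, hηK, rfl⟩ ?_
    rintro _ ⟨φ, ⟨L, hL⟩, hφc, -, hφK, rfl⟩
    obtain ⟨ψ, hψL, hψc, hψts, hψφ, hψ⟩ := hL.exists_localization hp hpn' hφc x₀ hr
    rw [inv_mul_le_iff₀ hC, setIntegral_univ]
    refine (csInf_le (hbdd Ω) ⟨ψ, hψL, hψc, hψts.trans h3,
      fun x hx => (hψφ x (hK2 hx)).symm ▸ hφK x hx, rfl⟩).trans ?_
    rwa [setIntegral_norm_fderiv_rpow_eq_integral hp0.ne' (hψts.trans h3)]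
  · refine csInf_le_csInf (hbdd _) ⟨_, η, ⟨_, hη⟩, hηc, hηts.trans h3, hηK, rfl⟩ ?_
    rintro _ ⟨φ, hL, hφc, hφts, hφK, rfl⟩
    refine ⟨φ, hL, hφc, Set.subset_univ _, hφK, ?_⟩
    rw [setIntegral_univ, setIntegral_norm_fderiv_rpow_eq_integral hp0.ne' hφts]
end
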